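/- arXiv:2311.11064 — 5 statements merged into one kernel-verified Lean document; each statement's English description precedes it below -/
import Mathlib

section
/- For every integer j ≥ 1, the sum of ∏_{i=1}^{j} r_i^{-4} over all j-tuples of positive integers with 1 ≤ r_1 < r_2 < ⋯ < r_j (equivalently, over all j-element finite sets of positive integers, of the product of the inverse fourth powers of their elements) converges and equals 2^{2j+1} π^{4j} / (4j+2)!. -/
open Filter Topology

/-- The elementary symmetric functions of a summable family are the power series coefficients of
`w ↦ ∏ (1 + w * a i)`. -/
theorem hasSum_pow_mul_tsum_card_eq {ι : Type*} {a : ι → ℂ} (ha : Summable fun i => ‖a i‖)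
    (w : ℂ) :
    HasSum (fun k : ℕ => w ^ k * ∑' s : {s : Finset ι // s.card = k}, ∏ i ∈ (s : Finset ι), a i)
      (∑' s : Finset ι, ∏ i ∈ s, (w * a i)) := by
  have hw : Summable fun i => ‖w * a i‖ := by simpa using ha.mul_left ‖w‖
  have h := (summable_finsetProd_of_summable_norm hw).hasSum
  rw [← (Equiv.sigmaFiberEquiv (Finset.card : Finset ι → ℕ)).hasSum_iff] at h
  refine (h.sigma fun k => (h.summable.sigma_factor k).hasSum).congr_fun fun k => ?_
  rw [← tsum_mul_left]
  refine tsum_congr fun s => ?_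
  simp [Equiv.sigmaFiberEquiv, Finset.prod_mul_distrib, s.2]

/-- Two power series with the same sum near zero have the same coefficients. -/
theorem eq_of_hasSum_pow_mul {f : ℂ → ℂ} {b c : ℕ → ℂ}
    (hb : ∀ w, HasSum (fun k => w ^ k * b k) (f w))
    (hc : ∀ w, HasSum (fun k => w ^ k * c k) (f w)) : b = c := by
  have key {b : ℕ → ℂ} (hb : ∀ w, HasSum (fun k => w ^ k * b k) (f w)) :
      HasFPowerSeriesAt f (FormalMultilinearSeries.ofScalars ℂ b) 0 := by
    rw [hasFPowerSeriesAt_iff]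
    exact Eventually.of_forall fun z => by
      simpa [FormalMultilinearSeries.coeff_ofScalars] using hb z
  ext n
  simpa [FormalMultilinearSeries.coeff_ofScalars] using
    congrArg (fun p => p.coeff n) ((key hb).eq_formalMultilinearSeries (key hc))

/-- The power series of `sin u * sinh u`, with `sinh u = sin (I * u) / I`. -/
theorem hasSum_sin_mul_sin_I_mul (u : ℂ) :
    HasSum (fun k : ℕ => Complex.I * ((-1) ^ k * 2 ^ (2 * k + 1) * u ^ (4 * k + 2) /
      (Nat.factorial (4 * k + 2) : ℂ))) (Complex.sin u * Complex.sin (Complex.I * u)) := by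
  have h := ((Complex.hasSum_cos ((1 - Complex.I) * u)).sub
    (Complex.hasSum_cos ((1 + Complex.I) * u))).div_const 2
  have hval : (Complex.cos ((1 - Complex.I) * u) - Complex.cos ((1 + Complex.I) * u)) / 2 =
      Complex.sin u * Complex.sin (Complex.I * u) := by
    rw [show (1 - Complex.I) * u = u - Complex.I * u by ring,
      show (1 + Complex.I) * u = u + Complex.I * u by ring, Complex.cos_sub, Complex.cos_add]
    ring
  have hm : (1 - Complex.I) ^ 2 = -2 * Complex.I := by linear_combination Complex.I_sq
  have hp : (1 + Complex.I) ^ 2 = 2 * Complex.I := by linear_combination Complex.I_sq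
  rw [hval] at h
  have hinj : Function.Injective fun k : ℕ => 2 * k + 1 := fun x y hxy => by
    simpa using hxy
  rw [← hinj.hasSum_iff] at h
  · refine h.congr_fun fun k => ?_
    have hI : Complex.I ^ (2 * k + 1) = (-1) ^ k * Complex.I := by
      rw [pow_succ, pow_mul, Complex.I_sq]
    have hodd : (-1 : ℂ) ^ (2 * k + 1) = -1 := Odd.neg_one_pow ⟨k, rfl⟩
    have hneg : (-2 : ℂ) ^ (2 * k + 1) = -2 ^ (2 * k + 1) := Odd.neg_pow ⟨k, rfl⟩ 2
    simp only [Function.comp_apply, mul_pow _ u, pow_mul _ 2 (2 * k + 1), hm, hp]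
    rw [mul_pow (-2), mul_pow 2, hI, hodd, hneg, show 2 * (2 * k + 1) = 4 * k + 2 by ring,
      ← pow_mul u, show 2 * (2 * k + 1) = 4 * k + 2 by ring]
    ring
  · intro n hn
    have he : Even n := by
      rw [← Nat.not_odd_iff_even]
      rintro ⟨k, rfl⟩
      exact hn ⟨k, rfl⟩
    have hneg : (-2 : ℂ) ^ n = 2 ^ n := he.neg_pow 2
    simp only [mul_pow _ u, pow_mul _ 2 n, hm, hp]
    rw [mul_pow (-2), mul_pow 2, hneg]
    ring

theorem summable_norm_inv_pow_four : Summable fun i : ℕ => ‖((i : ℂ) ^ 4)⁻¹‖ := by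
  simp

theorem tendsto_prod_one_add_mul_inv_pow_four (w : ℂ) :
    Tendsto (fun n : ℕ => ∏ j ∈ Finset.range n, (1 + w * (((j : ℂ) + 1) ^ 4)⁻¹)) atTop
      (𝓝 (∑' s : Finset ℕ, ∏ i ∈ s, (w * ((i : ℂ) ^ 4)⁻¹))) := by
  have hw : Summable fun i : ℕ => ‖w * ((i : ℂ) ^ 4)⁻¹‖ := by
    simpa only [norm_mul] using summable_norm_inv_pow_four.mul_left ‖w‖
  have h := (hasProd_one_add_of_hasSum_prod
    (summable_finsetProd_of_summable_norm hw).hasSum).tendsto_prod_nat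
  refine (h.comp (tendsto_add_atTop_nat 1)).congr fun n => ?_
  simp [Finset.prod_range_succ']

/-- Power series form of `∏ (1 - y ^ 4 / n ^ 4) = sin (π y) * sinh (π y) / (π y) ^ 2`. -/
theorem hasSum_pow_mul_tsum_prod_inv_pow_four (w : ℂ) :
    HasSum (fun k : ℕ => w ^ k *
        (2 ^ (2 * k + 1) * (Real.pi : ℂ) ^ (4 * k) / (Nat.factorial (4 * k + 2) : ℂ)))
      (∑' s : Finset ℕ, ∏ i ∈ s, (w * ((i : ℂ) ^ 4)⁻¹)) := by
  have hlim := tendsto_prod_one_add_mul_inv_pow_four w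
  rcases eq_or_ne w 0 with rfl | hw
  · have h1 : ∑' s : Finset ℕ, ∏ i ∈ s, ((0 : ℂ) * ((i : ℂ) ^ 4)⁻¹) = 1 :=
      tendsto_nhds_unique hlim (by simp)
    rw [h1]
    have h0 := hasSum_single (f := fun k : ℕ => (0 : ℂ) ^ k *
      (2 ^ (2 * k + 1) * (Real.pi : ℂ) ^ (4 * k) / (Nat.factorial (4 * k + 2) : ℂ))) 0
      fun k hk => by simp [hk]
    simpa using h0
  obtain ⟨y, hy⟩ := IsAlgClosed.exists_pow_nat_eq (-w) (n := 4) (by norm_num)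
  have hy0 : y ≠ 0 := by
    rintro rfl
    simp [eq_comm, hw] at hy
  have hpi : (Real.pi : ℂ) ≠ 0 := Complex.ofReal_ne_zero.2 Real.pi_ne_zero
  have hsin := (Complex.tendsto_euler_sin_prod y).mul
    (Complex.tendsto_euler_sin_prod (Complex.I * y))
  have heq := tendsto_nhds_unique (hsin.congr fun n => ?_)
    (hlim.const_mul (Complex.I * (Real.pi * y) ^ 2))
  · have h := (hasSum_sin_mul_sin_I_mul (Real.pi * y)).div_const (Complex.I * (Real.pi * y) ^ 2)
    rw [show Complex.I * (Real.pi * y) = Real.pi * (Complex.I * y) by ring, heq,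
      mul_div_cancel_left₀ _ (by simp [hpi, hy0])] at h
    refine h.congr_fun fun k => ?_
    have hw' : w = -y ^ 4 := by rw [hy, neg_neg]
    rw [hw', neg_pow, ← pow_mul]
    have := Complex.I_ne_zero
    field_simp
    ring
  · have hterm (j : ℕ) : 1 + w * (((j : ℂ) + 1) ^ 4)⁻¹ =
        (1 - y ^ 2 / ((j : ℂ) + 1) ^ 2) * (1 - (Complex.I * y) ^ 2 / ((j : ℂ) + 1) ^ 2) := by
      have hj : (j : ℂ) + 1 ≠ 0 := Nat.cast_add_one_ne_zero j
      rw [mul_pow, Complex.I_sq, show w = -y ^ 4 by rw [hy, neg_neg]]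
      field_simp
      ring
    simp only [hterm, Finset.prod_mul_distrib]
    ring

/-- For every integer `j ≥ 1`, the sum of `∏ 1/rᵢ⁴` over all `j`-element
finite sets of positive integers converges and equals `2^(2j+1) π^(4j) / (4j+2)!`. -/
theorem stmt_0 (j : ℕ) (hj : 1 ≤ j) :
    HasSum
      (fun s : {s : Finset ℕ // s.card = j ∧ 0 ∉ s} =>
        ∏ i ∈ (s : Finset ℕ), ((i : ℝ) ^ 4)⁻¹)
      (2 ^ (2 * j + 1) * Real.pi ^ (4 * j) / (Nat.factorial (4 * j + 2) : ℝ)) := by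
  have hcoeff := congrFun (eq_of_hasSum_pow_mul
    (hasSum_pow_mul_tsum_card_eq summable_norm_inv_pow_four)
    hasSum_pow_mul_tsum_prod_inv_pow_four) j
  have hsum : Summable fun s : {s : Finset ℕ // s.card = j} =>
      ∏ i ∈ (s : Finset ℕ), ((i : ℂ) ^ 4)⁻¹ :=
    (summable_finsetProd_of_summable_norm summable_norm_inv_pow_four).comp_injective
      Subtype.val_injective
  have h := hsum.hasSum
  rw [hcoeff] at h
  let e : {s : Finset ℕ // s.card = j ∧ 0 ∉ s} → {s : Finset ℕ // s.card = j} :=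
    fun s => ⟨s, s.2.1⟩
  have he : Function.Injective e := fun s t hst => Subtype.ext (Subtype.mk.inj hst)
  rw [← he.hasSum_iff] at h
  · rw [← Complex.hasSum_ofReal]
    push_cast
    exact h
  · intro s hs
    have h0 : 0 ∈ (s : Finset ℕ) := by
      by_contra h0
      exact hs ⟨⟨s, s.2, h0⟩, rfl⟩
    exact Finset.prod_eq_zero h0 (by simp)
end

section
/- Let (τ_n)_{n≥1} be a strictly increasing sequence of positive real numbers, and suppose there exist h > 0 and N₀ ∈ ℕ such that τ_n ≥ h n² for all n ≥ N₀. Then there exists a constant K > 0 (depending only on the sequence, h and N₀) such that for every j ≥ 1 the sum a_{2j} := ∑_{1 ≤ r_1 < r_2 < ⋯ < r_j} ∏_{i=1}^{j} τ_{r_i}^{-2} converges and satisfies a_{2j} ≤ K · 2^{2j+1} π^{4j} / (h^{2j} (4j+2)!). -/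
open Filter Topology

/-- The coefficients of a convergent power series in one variable are determined by its sum. -/
theorem coeff_unique_of_hasSum {𝕜 : Type*} [NontriviallyNormedField 𝕜] {a b : ℕ → 𝕜} {f : 𝕜 → 𝕜}
    (ha : ∀ z, HasSum (fun n => z ^ n * a n) (f z))
    (hb : ∀ z, HasSum (fun n => z ^ n * b n) (f z)) : a = b := by
  have key : ∀ c : ℕ → 𝕜, (∀ z, HasSum (fun n => z ^ n * c n) (f z)) →
      HasFPowerSeriesAt f (FormalMultilinearSeries.ofScalars 𝕜 c) 0 := by
    intro c hc
    rw [hasFPowerSeriesAt_iff]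
    refine Eventually.of_forall fun z => ?_
    simpa [FormalMultilinearSeries.coeff_ofScalars] using hc z
  exact FormalMultilinearSeries.ofScalars_series_injective 𝕜 𝕜
    ((key a ha).eq_formalMultilinearSeries (key b hb))

/-- The product `∏ (1 + 4 x⁴ / n⁴)` in closed form. -/
theorem tendsto_prod_one_add_four_mul_pow_four {x : ℂ} (hx : x ≠ 0) :
    Tendsto (fun n : ℕ => ∏ i ∈ Finset.range n, (1 + 4 * x ^ 4 * ((i : ℂ) ^ 4)⁻¹)) atTop
      (𝓝 ((Complex.cosh (2 * Real.pi * x) - Complex.cos (2 * Real.pi * x)) /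
        (4 * Real.pi ^ 2 * x ^ 2))) := by
  have hI := Complex.I_sq
  have hpi : (Real.pi : ℂ) ≠ 0 := by exact_mod_cast Real.pi_ne_zero
  have h := ((Complex.tendsto_euler_sin_prod ((1 + Complex.I) * x)).mul
    (Complex.tendsto_euler_sin_prod ((1 - Complex.I) * x))).div_const (2 * Real.pi ^ 2 * x ^ 2)
  rw [← tendsto_add_atTop_iff_nat 1]
  convert! h using 1
  · funext n
    rw [Finset.prod_range_succ', mul_mul_mul_comm, ← Finset.prod_mul_distrib]
    have e : (Real.pi : ℂ) * ((1 + Complex.I) * x) * (Real.pi * ((1 - Complex.I) * x))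
        = 2 * Real.pi ^ 2 * x ^ 2 := by
      linear_combination (-(Real.pi : ℂ) ^ 2 * x ^ 2) * hI
    rw [e, mul_div_cancel_left₀ _ (by simp [hpi, hx])]
    simp only [Nat.cast_zero, ne_eq, OfNat.ofNat_ne_zero, not_false_eq_true, zero_pow, inv_zero,
      mul_zero, add_zero, mul_one]
    refine Finset.prod_congr rfl fun i _ => ?_
    have hi : (i : ℂ) + 1 ≠ 0 := Nat.cast_add_one_ne_zero i
    push_cast
    field_simp
    linear_combination (2 * x ^ 2 * ((i : ℂ) + 1) ^ 2 - x ^ 4 * (Complex.I ^ 2 - 3)) * hI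
  · congr 1
    have e : Complex.cosh (2 * Real.pi * x) =
        Complex.cos (Real.pi * ((1 + Complex.I) * x) - Real.pi * ((1 - Complex.I) * x)) := by
      rw [← Complex.cos_mul_I]
      congr 1
      ring
    have e' : Complex.cos (2 * Real.pi * x) =
        Complex.cos (Real.pi * ((1 + Complex.I) * x) + Real.pi * ((1 - Complex.I) * x)) := by
      congr 1
      ring
    rw [e, e', Complex.cos_sub, Complex.cos_add]
    field_simp
    ring

theorem hasSum_cosh_sub_cos (z : ℂ) :
    HasSum (fun j : ℕ => 2 * z ^ (4 * j + 2) / ((4 * j + 2).factorial : ℂ))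
      (Complex.cosh z - Complex.cos z) := by
  have h := (Complex.hasSum_cosh z).sub (Complex.hasSum_cos z)
  have hinj : Function.Injective fun j : ℕ => 2 * j + 1 := fun a b hab => by
    simpa using hab
  rw [← hinj.hasSum_iff] at h
  · refine h.congr_fun fun j => ?_
    have e : 2 * (2 * j + 1) = 4 * j + 2 := by ring
    simp only [Function.comp_apply, e, (odd_two_mul_add_one j).neg_one_pow]
    ring
  · intro n hn
    have : Even n := by
      by_contra hodd
      obtain ⟨k, rfl⟩ := Nat.not_even_iff_odd.mp hodd
      exact hn ⟨k, rfl⟩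
    simp [this.neg_one_pow]

theorem summable_prod_inv_pow_four :
    Summable fun s : Finset ℕ => ∏ i ∈ s, ((i : ℝ) ^ 4)⁻¹ := by
  refine summable_finsetProd_of_summable_nonneg (fun i => by positivity) ?_
  exact Real.summable_nat_pow_inv.mpr (by norm_num)

theorem summable_prod_mul_inv_pow_four (w : ℂ) :
    Summable fun s : Finset ℕ => ∏ i ∈ s, w * ((i : ℂ) ^ 4)⁻¹ := by
  refine summable_finsetProd_of_summable_norm ?_
  simpa using (Real.summable_nat_pow_inv.mpr (by norm_num : 1 < 4)).mul_left ‖w‖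

theorem multipliable_one_add_mul_inv_pow_four (w : ℂ) :
    Multipliable fun i : ℕ => 1 + w * ((i : ℂ) ^ 4)⁻¹ :=
  (hasProd_one_add_of_hasSum_prod (summable_prod_mul_inv_pow_four w).hasSum).multipliable

theorem hasSum_prod_inv_pow_four (w : ℂ) :
    HasSum (fun j : ℕ => w ^ j *
      ((∑' s : {s : Finset ℕ // s.card = j}, ∏ i ∈ s.1, ((i : ℝ) ^ 4)⁻¹ : ℝ) : ℂ))
      (∏' i : ℕ, (1 + w * ((i : ℂ) ^ 4)⁻¹)) := by
  have h := summable_prod_mul_inv_pow_four w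
  rw [tprod_one_add h]
  have h2 := (Equiv.sigmaFiberEquiv (Finset.card : Finset ℕ → ℕ)).hasSum_iff.mpr h.hasSum
  refine h2.sigma fun j => ?_
  have h3 := (summable_prod_inv_pow_four.comp_injective
    (Subtype.val_injective (p := fun s : Finset ℕ => s.card = j))).hasSum
  have h4 := (Complex.hasSum_ofReal.mpr h3).mul_left (w ^ j)
  refine h4.congr_fun fun s => ?_
  simp [Finset.prod_mul_distrib, s.2, Equiv.sigmaFiberEquiv]

theorem tsum_prod_inv_pow_four (j : ℕ) :
    ∑' s : {s : Finset ℕ // s.card = j}, ∏ i ∈ s.1, ((i : ℝ) ^ 4)⁻¹ =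
      2 ^ (2 * j + 1) * Real.pi ^ (4 * j) / ((4 * j + 2).factorial : ℝ) := by
  have hpi : (Real.pi : ℂ) ≠ 0 := by exact_mod_cast Real.pi_ne_zero
  have key : (fun j : ℕ => ((∑' s : {s : Finset ℕ // s.card = j},
      ∏ i ∈ s.1, ((i : ℝ) ^ 4)⁻¹ : ℝ) : ℂ)) =
      fun j => 2 ^ (2 * j + 1) * (Real.pi : ℂ) ^ (4 * j) / ((4 * j + 2).factorial : ℂ) := by
    refine coeff_unique_of_hasSum hasSum_prod_inv_pow_four fun w => ?_
    obtain ⟨x, hx⟩ := IsAlgClosed.exists_pow_nat_eq (w / 4) (n := 4) (by norm_num)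
    obtain rfl : w = 4 * x ^ 4 := by rw [hx]; ring
    rcases eq_or_ne x 0 with rfl | hx0
    · have h0 := hasSum_single (f := fun j : ℕ => (4 * (0 : ℂ) ^ 4) ^ j *
        (2 ^ (2 * j + 1) * (Real.pi : ℂ) ^ (4 * j) / ((4 * j + 2).factorial : ℂ))) 0
        fun n hn => by simp [hn]
      simpa using h0
    · have hp := (multipliable_one_add_mul_inv_pow_four (4 * x ^ 4)).hasProd.tendsto_prod_nat
      rw [tendsto_nhds_unique hp (tendsto_prod_one_add_four_mul_pow_four hx0)]
      refine ((hasSum_cosh_sub_cos (2 * Real.pi * x)).div_const _).congr_fun fun j => ?_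
      have e : (2 * Real.pi * x) ^ (4 * j + 2) =
          (4 * x ^ 4) ^ j * 2 ^ (2 * j) * Real.pi ^ (4 * j) * (4 * Real.pi ^ 2 * x ^ 2) := by
        simp only [pow_add, pow_mul, ← mul_pow]
        ring
      rw [e]
      field_simp
      ring
  apply Complex.ofReal_injective
  rw [congrFun key j]
  push_cast
  rfl

/-- Let `(τ_n)_{n≥1}` be a strictly increasing sequence of positive reals,
and suppose there are `h > 0` and `N₀` with `τ_n ≥ h n²` for all `n ≥ N₀`. Then there is a
constant `K > 0` such that for every `j ≥ 1` the elementary symmetric sum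
`a_{2j} = ∑_{1 ≤ r₁ < ⋯ < r_j} ∏ τ_{rᵢ}⁻²` converges and satisfies
`a_{2j} ≤ K · 2^(2j+1) π^(4j) / (h^(2j) (4j+2)!)`. -/
theorem stmt_3 (τ : ℕ → ℝ)
    (hpos : ∀ n : ℕ, 1 ≤ n → 0 < τ n)
    (hmono : ∀ m n : ℕ, 1 ≤ m → m < n → τ m < τ n)
    (h : ℝ) (hh : 0 < h) (N₀ : ℕ)
    (hge : ∀ n : ℕ, N₀ ≤ n → h * (n : ℝ) ^ 2 ≤ τ n) :
    ∃ K > (0 : ℝ), ∀ j : ℕ, 1 ≤ j →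
      ∃ a : ℝ,
        HasSum
          (fun s : {s : Finset ℕ // s.card = j ∧ 0 ∉ s} =>
            ∏ i ∈ (s : Finset ℕ), (τ i ^ 2)⁻¹) a ∧
        a ≤ K * 2 ^ (2 * j + 1) * Real.pi ^ (4 * j) /
              (h ^ (2 * j) * (Nat.factorial (4 * j + 2) : ℝ)) := by
  set y : ℕ → ℝ := fun i => ((i : ℝ) ^ 4)⁻¹ with hy
  have hy0 : ∀ i, 0 ≤ y i := fun i => by positivity
  obtain ⟨M, hM1, hM⟩ : ∃ M : ℝ, 1 ≤ M ∧ ∀ i, i < N₀ → 1 ≤ i →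
      (τ i ^ 2)⁻¹ ≤ M * ((h ^ 2)⁻¹ * y i) := by
    refine ⟨1 + ∑ i ∈ Finset.range N₀, (τ i ^ 2)⁻¹ * (h ^ 2 * (i : ℝ) ^ 4), ?_, fun i hi hi1 => ?_⟩
    · exact le_add_of_nonneg_right (Finset.sum_nonneg fun i _ => by positivity)
    · have hle := Finset.single_le_sum (f := fun i => (τ i ^ 2)⁻¹ * (h ^ 2 * (i : ℝ) ^ 4))
        (fun i _ => by positivity) (Finset.mem_range.mpr hi)
      have hi0 : (0 : ℝ) < i := by exact_mod_cast hi1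
      calc (τ i ^ 2)⁻¹ = (τ i ^ 2)⁻¹ * (h ^ 2 * (i : ℝ) ^ 4) * ((h ^ 2)⁻¹ * y i) := by
            simp only [hy]
            field_simp
        _ ≤ _ := by
            gcongr
            linarith
  have hterm : ∀ i, 1 ≤ i →
      (τ i ^ 2)⁻¹ ≤ (if i < N₀ then M else 1) * ((h ^ 2)⁻¹ * y i) := by
    intro i hi1
    split_ifs with hi
    · exact hM i hi hi1
    · have hi0 : (0 : ℝ) < i := by exact_mod_cast hi1
      have hle := hge i (not_lt.mp hi)
      rw [one_mul, ← mul_inv]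
      gcongr
      calc h ^ 2 * (i : ℝ) ^ 4 = (h * (i : ℝ) ^ 2) ^ 2 := by ring
        _ ≤ τ i ^ 2 := by gcongr
  have hprod : ∀ s : Finset ℕ, 0 ∉ s → ∏ i ∈ s, (τ i ^ 2)⁻¹ ≤
      M ^ N₀ * (h ^ (2 * s.card))⁻¹ * ∏ i ∈ s, y i := by
    intro s hs
    calc ∏ i ∈ s, (τ i ^ 2)⁻¹
        ≤ ∏ i ∈ s, ((if i < N₀ then M else 1) * ((h ^ 2)⁻¹ * y i)) :=
          Finset.prod_le_prod (fun i _ => by positivity) fun i hi =>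
            hterm i (Nat.one_le_iff_ne_zero.mpr fun h0 => hs (h0 ▸ hi))
      _ = M ^ (s.filter (· < N₀)).card * (h ^ (2 * s.card))⁻¹ * ∏ i ∈ s, y i := by
          rw [Finset.prod_mul_distrib, Finset.prod_mul_distrib, ← Finset.prod_filter,
            Finset.prod_const, Finset.prod_const, inv_pow, ← pow_mul, mul_assoc]
      _ ≤ _ := by
          have hcard : (s.filter (· < N₀)).card ≤ N₀ := by
            simpa using Finset.card_le_card (s := s.filter (· < N₀)) (t := Finset.range N₀)
              fun i hi => by simpa using (Finset.mem_filter.mp hi).2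
          have := Finset.prod_nonneg fun i (_ : i ∈ s) => hy0 i
          gcongr
  refine ⟨M ^ N₀, by positivity, fun j _ => ?_⟩
  have hS := summable_prod_inv_pow_four.comp_injective
    (Subtype.val_injective (p := fun s : Finset ℕ => s.card = j))
  let φ : {s : Finset ℕ // s.card = j ∧ 0 ∉ s} → {s : Finset ℕ // s.card = j} :=
    fun s => ⟨s, s.2.1⟩
  have hφ : Function.Injective φ := fun s t hst => Subtype.ext (Subtype.mk.inj hst)
  have hT := (hS.comp_injective hφ).mul_left (M ^ N₀ * (h ^ (2 * j))⁻¹)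
  have hle : ∀ s : {s : Finset ℕ // s.card = j ∧ 0 ∉ s}, ∏ i ∈ (s : Finset ℕ), (τ i ^ 2)⁻¹ ≤
      M ^ N₀ * (h ^ (2 * j))⁻¹ * ∏ i ∈ (s : Finset ℕ), y i := fun s => by
    simpa only [s.2.1] using hprod s s.2.2
  have hsum := Summable.of_nonneg_of_le
    (fun s => Finset.prod_nonneg fun i _ => by positivity) hle hT
  refine ⟨_, hsum.hasSum, (hsum.tsum_le_tsum hle hT).trans ?_⟩
  rw [tsum_mul_left]
  calc _ ≤ M ^ N₀ * (h ^ (2 * j))⁻¹ *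
        ∑' s : {s : Finset ℕ // s.card = j}, ∏ i ∈ s.1, ((i : ℝ) ^ 4)⁻¹ := by
        gcongr
        exact tsum_comp_le_tsum_of_inj hS (fun s => Finset.prod_nonneg fun i _ => hy0 i) hφ
    _ = _ := by
        rw [tsum_prod_inv_pow_four]
        field_simp
end

section
/- Under the Hecke-pair setup below, for every u with 0 < u < π/2 one has ∫₀^∞ R(t) · cosh((π/2 − u)t) dt = (π/2) e^{iπσ₀/2} e^{−iσ₀u} f(−e^{−iu}/√(4N)) + (π/2) e^{−iπσ₀/2} e^{iσ₀u} f(e^{iu}/√(4N)), the integral converging absolutely. -/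
/-- The sum `f(z) = ∑_{n≥1} a(n) e^{2πinz}` attached to coefficients `a : ℕ → ℝ`. -/
noncomputable def heckeSum (a : ℕ → ℝ) (z : ℂ) : ℂ :=
  ∑' n : ℕ, (a (n + 1) : ℂ) * Complex.exp (2 * Real.pi * Complex.I * ((n : ℂ) + 1) * z)

open MeasureTheory Set Filter Topology Complex

theorem norm_cpow_mul_cexp_neg_mul (s w : ℂ) {y : ℝ} (hy : 0 < y) :
    ‖(y : ℂ) ^ (s - 1) * cexp (-(w * y))‖ = y ^ (s.re - 1) * Real.exp (-(w.re * y)) := by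
  rw [norm_mul, norm_cpow_eq_rpow_re_of_pos hy, norm_exp]
  simp

theorem integrableOn_rpow_mul_exp_neg_mul {a r : ℝ} (ha : 0 < a) (hr : 0 < r) :
    IntegrableOn (fun y : ℝ ↦ y ^ (a - 1) * Real.exp (-(r * y))) (Ioi 0) := by
  simpa using integrableOn_rpow_mul_exp_neg_mul_rpow (s := a - 1) (p := 1) (b := r)
    (by linarith) one_pos hr

theorem aestronglyMeasurable_cpow_mul_cexp_neg_mul (s w : ℂ) :
    AEStronglyMeasurable (fun y : ℝ ↦ (y : ℂ) ^ (s - 1) * cexp (-(w * y)))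
      (volume.restrict (Ioi 0)) := by
  refine ContinuousOn.aestronglyMeasurable (fun y hy ↦ ?_) measurableSet_Ioi
  refine ContinuousAt.continuousWithinAt (ContinuousAt.mul ?_ (by fun_prop))
  exact continuousAt_ofReal_cpow_const _ _ (Or.inr (ne_of_gt hy))

theorem integrableOn_cpow_mul_cexp_neg_mul {s w : ℂ} (hs : 0 < s.re) (hw : 0 < w.re) :
    IntegrableOn (fun y : ℝ ↦ (y : ℂ) ^ (s - 1) * cexp (-(w * y))) (Ioi 0) := by
  refine (integrableOn_rpow_mul_exp_neg_mul hs hw).mono'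
    (aestronglyMeasurable_cpow_mul_cexp_neg_mul s w) ?_
  filter_upwards [ae_restrict_mem measurableSet_Ioi] with y hy
  exact (norm_cpow_mul_cexp_neg_mul s w hy).le

theorem differentiableAt_integral_cpow_mul_cexp_neg_mul {s w : ℂ} (hs : 0 < s.re)
    (hw : 0 < w.re) :
    DifferentiableAt ℂ (fun w : ℂ ↦ ∫ y : ℝ in Ioi 0, (y : ℂ) ^ (s - 1) * cexp (-(w * y))) w := by
  have hopen : IsOpen {z : ℂ | w.re / 2 < z.re} := isOpen_lt continuous_const continuous_re
  refine (hasDerivAt_integral_of_dominated_loc_of_deriv_le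
    (F' := fun z (y : ℝ) ↦ -((y : ℂ) ^ ((s + 1) - 1) * cexp (-(z * y))))
    (bound := fun y : ℝ ↦ y ^ ((s.re + 1) - 1) * Real.exp (-(w.re / 2 * y)))
    (hopen.mem_nhds (show w.re / 2 < w.re by linarith))
    (.of_forall fun z ↦ aestronglyMeasurable_cpow_mul_cexp_neg_mul s z)
    (integrableOn_cpow_mul_cexp_neg_mul hs hw)
    (aestronglyMeasurable_cpow_mul_cexp_neg_mul (s + 1) w).neg ?_
    (integrableOn_rpow_mul_exp_neg_mul (by linarith) (by linarith)) ?_).2.differentiableAt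
  · filter_upwards [ae_restrict_mem measurableSet_Ioi] with y hy z hz
    have hy : 0 < y := hy
    have hz : w.re / 2 < z.re := hz
    rw [norm_neg, norm_cpow_mul_cexp_neg_mul _ _ hy, add_re, one_re]
    gcongr
  · filter_upwards [ae_restrict_mem measurableSet_Ioi] with y hy z hz
    have hy : (y : ℂ) ≠ 0 := ofReal_ne_zero.mpr (ne_of_gt hy)
    have h : HasDerivAt (fun z : ℂ ↦ cexp (-(z * y))) (cexp (-(z * y)) * (-(1 * (y : ℂ)))) z :=
      (((hasDerivAt_id z).mul_const (y : ℂ)).neg).cexp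
    refine (h.const_mul ((y : ℂ) ^ (s - 1))).congr_deriv ?_
    rw [add_sub_right_comm, cpow_add _ _ hy, cpow_one]
    ring

theorem integral_cpow_mul_cexp_neg_mul {s w : ℂ} (hs : 0 < s.re) (hw : 0 < w.re) :
    ∫ y : ℝ in Ioi 0, (y : ℂ) ^ (s - 1) * cexp (-(w * y)) = w ^ (-s) * Gamma s := by
  have hopen : IsOpen {z : ℂ | 0 < z.re} := isOpen_lt continuous_const continuous_re
  have hF : AnalyticOnNhd ℂ
      (fun w : ℂ ↦ ∫ y : ℝ in Ioi 0, (y : ℂ) ^ (s - 1) * cexp (-(w * y))) {z : ℂ | 0 < z.re} :=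
    DifferentiableOn.analyticOnNhd (fun z hz ↦
      (differentiableAt_integral_cpow_mul_cexp_neg_mul hs hz).differentiableWithinAt) hopen
  have hG : AnalyticOnNhd ℂ (fun w : ℂ ↦ w ^ (-s) * Gamma s) {z : ℂ | 0 < z.re} :=
    DifferentiableOn.analyticOnNhd (fun z hz ↦
      ((differentiableAt_id.cpow_const (Or.inl hz)).mul_const _).differentiableWithinAt) hopen
  refine hF.eqOn_of_preconnected_of_frequently_eq hG
    (convex_halfSpace_re_gt 0).isPreconnected (z₀ := ((1 : ℝ) : ℂ)) (by simp) ?_ hw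
  have hreal : ∀ᶠ r : ℝ in 𝓝[≠] 1, ∫ y : ℝ in Ioi 0, (y : ℂ) ^ (s - 1) * cexp (-((r : ℂ) * y)) =
      (r : ℂ) ^ (-s) * Gamma s := by
    filter_upwards [nhdsWithin_le_nhds (lt_mem_nhds one_pos)] with r hr
    rw [integral_cpow_mul_exp_neg_mul_Ioi hs hr, one_div, inv_cpow, cpow_neg]
    rw [arg_ofReal_of_nonneg hr.le]
    exact Real.pi_pos.ne
  refine Tendsto.frequently (f := fun r : ℝ ↦ (r : ℂ)) ?_ hreal.frequently
  refine tendsto_nhdsWithin_of_tendsto_nhds_of_eventually_within _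
    (continuous_ofReal.continuousAt.tendsto.mono_left nhdsWithin_le_nhds) ?_
  filter_upwards [self_mem_nhdsWithin] with r hr
  simpa using hr

theorem mellin_cexp_neg_mul {s w : ℂ} (hs : 0 < s.re) (hw : 0 < w.re) :
    mellin (fun y : ℝ ↦ cexp (-(w * y))) s = w ^ (-s) * Gamma s := by
  simpa [mellin] using integral_cpow_mul_cexp_neg_mul hs hw

/-- The Gamma function decays on vertical lines faster than `exp (-φ|t|)` for all `φ < π / 2`. -/
theorem exists_norm_Gamma_vertical_le {c φ : ℝ} (hc : 0 < c) (hφ0 : 0 ≤ φ)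
    (hφ : φ < Real.pi / 2) :
    ∃ K, ∀ t : ℝ, ‖Gamma (c + t * I)‖ ≤ K * Real.exp (-φ * |t|) := by
  have key : ∀ ψ t : ℝ, |ψ| < Real.pi / 2 → ‖Gamma (c + t * I)‖ * Real.exp (ψ * t) ≤
      ∫ y : ℝ in Ioi 0, y ^ (c - 1) * Real.exp (-(Real.cos ψ * y)) := by
    intro ψ t hψ
    have hψ' := abs_lt.mp hψ
    have hre : (cexp (ψ * I)).re = Real.cos ψ := by simp [exp_ofReal_mul_I_re]
    have h := integral_cpow_mul_cexp_neg_mul (s := c + t * I) (w := cexp (ψ * I))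
      (by simpa using hc) (by rw [hre]; exact Real.cos_pos_of_mem_Ioo ⟨hψ'.1, hψ'.2⟩)
    have hpow : ‖cexp (ψ * I) ^ (-(c + t * I))‖ = Real.exp (ψ * t) := by
      rw [cpow_def_of_ne_zero (Complex.exp_ne_zero _), log_exp, norm_exp]
      · simp
      · simp; linarith [Real.pi_pos]
      · simp; linarith [Real.pi_pos]
    rw [← hpow, mul_comm, ← norm_mul, ← h]
    refine (norm_integral_le_integral_norm _).trans_eq
      (setIntegral_congr_fun measurableSet_Ioi fun y hy ↦ ?_)
    rw [norm_cpow_mul_cexp_neg_mul _ _ hy, hre]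
    simp
  refine ⟨∫ y : ℝ in Ioi 0, y ^ (c - 1) * Real.exp (-(Real.cos φ * y)), fun t ↦ ?_⟩
  rw [neg_mul, Real.exp_neg, ← div_eq_mul_inv, le_div_iff₀ (Real.exp_pos _)]
  rcases le_total 0 t with ht | ht
  · rw [abs_of_nonneg ht]
    exact key φ t (by rwa [abs_of_nonneg hφ0])
  · have := key (-φ) t (by rwa [abs_neg, abs_of_nonneg hφ0])
    rw [abs_of_nonpos ht]
    rwa [Real.cos_neg, neg_mul, ← mul_neg] at this

theorem integrable_exp_neg_mul_abs {δ : ℝ} (hδ : 0 < δ) :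
    Integrable fun t : ℝ ↦ Real.exp (-δ * |t|) := by
  rw [← integrableOn_univ, ← Iic_union_Ioi (a := (0 : ℝ))]
  refine IntegrableOn.union ?_ ?_
  · refine (integrableOn_exp_mul_Iic hδ 0).congr_fun (fun t ht ↦ ?_) measurableSet_Iic
    simp only [abs_of_nonpos (mem_Iic.mp ht), neg_mul_neg]
  · refine (exp_neg_integrableOn_Ioi 0 hδ).congr_fun (fun t ht ↦ ?_) measurableSet_Ioi
    simp only [abs_of_pos (mem_Ioi.mp ht)]

theorem integrable_vertical_of_norm_le {g : ℂ → ℂ} {σ M δ : ℝ} (hδ : 0 < δ)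
    (hg : Continuous fun t : ℝ ↦ g (σ + t * I))
    (hbound : ∀ t : ℝ, ‖g (σ + t * I)‖ ≤ M * Real.exp (-δ * |t|)) :
    Integrable fun t : ℝ ↦ g (σ + t * I) :=
  ((integrable_exp_neg_mul_abs hδ).const_mul M).mono' hg.aestronglyMeasurable
    (.of_forall hbound)

theorem norm_cexp_neg_mul_I_vertical (φ σ t : ℝ) :
    ‖cexp (-(φ * I * (σ + t * I)))‖ = Real.exp (φ * t) := by
  rw [norm_exp]
  simp

theorem cexp_mul_I_cpow_neg {φ : ℝ} (hφ : |φ| < Real.pi / 2) (s : ℂ) :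
    cexp (φ * I) ^ (-s) = cexp (-(φ * I * s)) := by
  have hφ' := abs_lt.mp hφ
  rw [cpow_def_of_ne_zero (Complex.exp_ne_zero _), log_exp]
  · ring_nf
  · simp; linarith [Real.pi_pos]
  · simp; linarith [Real.pi_pos]

theorem cexp_mul_I_re_pos {φ : ℝ} (hφ : |φ| < Real.pi / 2) : 0 < (cexp (φ * I)).re := by
  rw [exp_ofReal_mul_I_re]
  exact Real.cos_pos_of_mem_Ioo (abs_lt.mp hφ)

theorem exp_neg_mul_abs_mul_exp_le {φ ψ t : ℝ} :
    Real.exp (-ψ * |t|) * Real.exp (φ * t) ≤ Real.exp (-(ψ - |φ|) * |t|) := by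
  rw [← Real.exp_add, Real.exp_le_exp]
  have := (le_abs_self (φ * t)).trans_eq (abs_mul φ t)
  linarith

/-- `Γ(s) e^{-iφs}` is integrable on vertical lines when `|φ| < π / 2`. -/
theorem integrable_Gamma_mul_cexp_vertical {c φ : ℝ} (hc : 0 < c) (hφ : |φ| < Real.pi / 2) :
    Integrable fun t : ℝ ↦ cexp (-(φ * I * (c + t * I))) * Gamma (c + t * I) := by
  obtain ⟨ψ, hφψ, hψ⟩ := exists_between hφ
  obtain ⟨K, hK⟩ := exists_norm_Gamma_vertical_le hc ((abs_nonneg φ).trans hφψ.le) hψ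
  refine integrable_vertical_of_norm_le (g := fun s ↦ cexp (-(φ * I * s)) * Gamma s)
    (M := K) (sub_pos.mpr hφψ) ?_ fun t ↦ ?_
  · refine Continuous.mul (by fun_prop) (continuous_iff_continuousAt.mpr fun t ↦ ?_)
    have hΓ : ContinuousAt Gamma (c + t * I) := (differentiableAt_Gamma _ fun m hm ↦ by
      have := congrArg re hm
      simp only [add_re, ofReal_re, re_ofReal_mul, I_re, mul_zero, add_zero, neg_re,
        natCast_re] at this
      have := m.cast_nonneg (α := ℝ)
      linarith).continuousAt
    exact hΓ.comp (f := fun t : ℝ ↦ (c + t * I : ℂ)) (by fun_prop)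
  · rw [norm_mul, norm_cexp_neg_mul_I_vertical, mul_comm]
    have hK0 : 0 ≤ K := by simpa using (norm_nonneg _).trans (hK 0)
    calc _ ≤ K * Real.exp (-ψ * |t|) * Real.exp (φ * t) := by gcongr; exact hK t
      _ ≤ K * Real.exp (-(ψ - |φ|) * |t|) := by
        rw [mul_assoc]
        gcongr
        exact exp_neg_mul_abs_mul_exp_le

/-- Mellin inversion for `y ↦ exp (-e^{iφ} y)`. -/
theorem integral_cpow_mul_cexp_mul_Gamma_vertical {c φ x : ℝ} (hc : 0 < c)
    (hφ : |φ| < Real.pi / 2) (hx : 0 < x) :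
    ∫ t : ℝ, (x : ℂ) ^ (-(c + t * I)) * (cexp (-(φ * I * (c + t * I))) * Gamma (c + t * I)) =
      2 * Real.pi * cexp (-(cexp (φ * I) * x)) := by
  have hre := cexp_mul_I_re_pos hφ
  have hmellin : ∀ t : ℝ, mellin (fun y : ℝ ↦ cexp (-(cexp (φ * I) * y))) (c + t * I) =
      cexp (-(φ * I * (c + t * I))) * Gamma (c + t * I) := fun t ↦ by
    rw [mellin_cexp_neg_mul (by simpa using hc) hre, cexp_mul_I_cpow_neg hφ]
  have h := mellinInv_mellin_eq c (fun y : ℝ ↦ cexp (-(cexp (φ * I) * y))) hx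
    (integrableOn_cpow_mul_cexp_neg_mul (by simpa using hc) hre)
    (by simpa only [VerticalIntegrable, hmellin] using integrable_Gamma_mul_cexp_vertical hc hφ)
    (by fun_prop)
  simp only [mellinInv, hmellin, smul_eq_mul] at h
  rw [← h, real_smul, ← mul_assoc]
  push_cast
  rw [mul_one_div_cancel (mul_ne_zero two_ne_zero (ofReal_ne_zero.mpr Real.pi_ne_zero)), one_mul]

theorem integral_vertical_eq_of_norm_le {g : ℂ → ℂ} (hg : Differentiable ℂ g) {σ₁ σ₂ M δ : ℝ}
    (hσ : σ₁ ≤ σ₂) (hδ : 0 < δ)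
    (hbound : ∀ σ t : ℝ, σ₁ ≤ σ → σ ≤ σ₂ → ‖g (σ + t * I)‖ ≤ M * Real.exp (-δ * |t|)) :
    ∫ t : ℝ, g (σ₁ + t * I) = ∫ t : ℝ, g (σ₂ + t * I) := by
  have hcont : Continuous g := hg.continuous
  have hvert : ∀ σ : ℝ, σ₁ ≤ σ → σ ≤ σ₂ → Tendsto (fun T : ℝ ↦ ∫ t in -T..T, g (σ + t * I)) atTop
      (𝓝 (∫ t : ℝ, g (σ + t * I))) := fun σ h₁ h₂ ↦
    intervalIntegral_tendsto_integral
      (integrable_vertical_of_norm_le hδ (by fun_prop) fun t ↦ hbound σ t h₁ h₂)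
      tendsto_neg_atTop_atBot tendsto_id
  have hdecay : Tendsto (fun T : ℝ ↦ M * Real.exp (-δ * T) * |σ₂ - σ₁|) atTop (𝓝 0) := by
    have : Tendsto (fun T : ℝ ↦ Real.exp (-δ * T)) atTop (𝓝 0) :=
      Real.tendsto_exp_atBot.comp (tendsto_id.const_mul_atTop_of_neg (neg_neg_of_pos hδ))
    simpa using (this.const_mul M).mul_const |σ₂ - σ₁|
  have hhor : ∀ ε : ℝ, |ε| = 1 →
      Tendsto (fun T : ℝ ↦ ∫ x in σ₁..σ₂, g (x + (ε * T : ℝ) * I)) atTop (𝓝 0) := fun ε hε ↦ by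
    refine squeeze_zero_norm' ?_ hdecay
    filter_upwards [eventually_ge_atTop 0] with T hT
    refine intervalIntegral.norm_integral_le_of_norm_le_const fun x hx ↦ ?_
    rw [uIoc_of_le hσ] at hx
    simpa [abs_mul, hε, abs_of_nonneg hT] using hbound x (ε * T) hx.1.le hx.2
  have hrect : ∀ T : ℝ, (∫ x in σ₁..σ₂, g (x + ((-1) * T : ℝ) * I)) -
      (∫ x in σ₁..σ₂, g (x + (1 * T : ℝ) * I)) + I * (∫ t in -T..T, g (σ₂ + t * I)) -
      I * (∫ t in -T..T, g (σ₁ + t * I)) = 0 := fun T ↦ by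
    simpa using integral_boundary_rect_eq_zero_of_differentiableOn g (σ₁ + (-T : ℝ) * I)
      (σ₂ + T * I) hg.differentiableOn
  have hlim := (((hhor (-1) (by simp)).sub (hhor 1 (by simp))).add
    ((hvert σ₂ hσ le_rfl).const_mul I)).sub ((hvert σ₁ le_rfl hσ).const_mul I)
  simp only [hrect] at hlim
  have h := tendsto_nhds_unique hlim tendsto_const_nhds
  rw [sub_zero, zero_add, ← mul_sub] at h
  exact (sub_eq_zero.mp ((mul_eq_zero.mp h).resolve_left I_ne_zero)).symm

theorem one_add_abs_rpow_le {B ε : ℝ} (hε : 0 < ε) :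
    ∃ K, 0 ≤ K ∧ ∀ t : ℝ, (1 + |t|) ^ B ≤ K * Real.exp (ε * |t|) := by
  refine ⟨(max B 0 / |ε|) ^ max B 0 * Real.exp ε, by positivity, fun t ↦ ?_⟩
  have h₁ : (1 : ℝ) ≤ 1 + |t| := by linarith [abs_nonneg t]
  have h := ProbabilityTheory.rpow_abs_le_mul_exp_abs (1 + |t|) (le_max_right B 0) hε.ne'
  rw [abs_of_nonneg (zero_le_one.trans h₁), abs_of_pos hε, mul_add, mul_one, Real.exp_add] at h
  rw [abs_of_pos hε, mul_assoc]
  exact (Real.rpow_le_rpow_of_exponent_le h₁ (le_max_left B 0)).trans h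

/-- Polynomial growth times `e^{-π|t|/2}` in a strip gives exponential decay after twisting by
`e^{-iφs}` with `|φ| < π / 2`. -/
theorem exists_norm_mul_cexp_strip_le {Λ : ℂ → ℂ} {σ₁ σ₂ C B φ : ℝ} (hφ : |φ| < Real.pi / 2)
    (h : ∀ σ t : ℝ, σ₁ ≤ σ → σ ≤ σ₂ →
      ‖Λ (σ + t * I)‖ ≤ C * (1 + |t|) ^ B * Real.exp (-Real.pi * |t| / 2)) :
    ∃ M δ : ℝ, 0 < δ ∧ ∀ σ t : ℝ, σ₁ ≤ σ → σ ≤ σ₂ →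
      ‖Λ (σ + t * I) * cexp (-(φ * I * (σ + t * I)))‖ ≤ M * Real.exp (-δ * |t|) := by
  obtain ⟨ψ, hφψ, hψ⟩ := exists_between hφ
  obtain ⟨K, hK0, hK⟩ := one_add_abs_rpow_le (B := B) (sub_pos.mpr hψ)
  refine ⟨|C| * K, ψ - |φ|, sub_pos.mpr hφψ, fun σ t h₁ h₂ ↦ ?_⟩
  rw [norm_mul, norm_cexp_neg_mul_I_vertical]
  calc _ ≤ C * (1 + |t|) ^ B * Real.exp (-Real.pi * |t| / 2) * Real.exp (φ * t) := by
        gcongr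
        exact h σ t h₁ h₂
    _ ≤ |C| * (K * Real.exp ((Real.pi / 2 - ψ) * |t|)) * Real.exp (-Real.pi * |t| / 2) *
        Real.exp (φ * t) := by
        gcongr
        · exact le_abs_self C
        · exact hK t
    _ = |C| * K * (Real.exp (-ψ * |t|) * Real.exp (φ * t)) := by
        have : Real.exp (-ψ * |t|) =
            Real.exp ((Real.pi / 2 - ψ) * |t|) * Real.exp (-Real.pi * |t| / 2) := by
          rw [← Real.exp_add]
          ring_nf
        rw [this]
        ring
    _ ≤ |C| * K * Real.exp (-(ψ - |φ|) * |t|) := by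
        gcongr
        exact exp_neg_mul_abs_mul_exp_le

theorem summable_norm_coeff_mul_rpow {a : ℕ → ℝ} {A C β c : ℝ} (hA : 0 < A)
    (ha : ∀ n : ℕ, |a n| ≤ C * (n : ℝ) ^ β) (hc : β + 1 < c) :
    Summable fun n : ℕ ↦ |a (n + 1)| * (A * (n + 1)) ^ (-c) := by
  have h : Summable fun n : ℕ ↦ C * A ^ (-c) * ((n + 1 : ℕ) : ℝ) ^ (β - c) :=
    ((summable_nat_add_iff 1).mpr (Real.summable_nat_rpow.mpr (by linarith))).mul_left _
  refine h.of_nonneg_of_le (fun n ↦ by positivity) fun n ↦ ?_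
  have hn : (0 : ℝ) < n + 1 := by positivity
  rw [Real.mul_rpow hA.le hn.le]
  calc _ ≤ C * ((n + 1 : ℕ) : ℝ) ^ β * (A ^ (-c) * (n + 1) ^ (-c)) := by
        gcongr
        exact ha (n + 1)
    _ = _ := by
        push_cast
        rw [sub_eq_add_neg, Real.rpow_add hn]
        ring

/-- The inverse Mellin transform of a completed Dirichlet series, on a line of absolute
convergence. -/
theorem integral_completed_dirichlet_vertical {a : ℕ → ℝ} {A C β c φ : ℝ} (hA : 0 < A)
    (ha : ∀ n : ℕ, |a n| ≤ C * (n : ℝ) ^ β) (hc : β + 1 < c) (hc0 : 0 < c)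
    (hφ : |φ| < Real.pi / 2) {Λ : ℂ → ℂ}
    (hΛ : ∀ s : ℂ, s.re = c → Λ s = (A : ℂ) ^ (-s) * Gamma s *
      ∑' n : ℕ, (a (n + 1) : ℂ) * ((n : ℂ) + 1) ^ (-s)) :
    ∫ t : ℝ, Λ (c + t * I) * cexp (-(φ * I * (c + t * I))) =
      2 * Real.pi * ∑' n : ℕ, (a (n + 1) : ℂ) * cexp (-(cexp (φ * I) * (A * (n + 1)))) := by
  set W : ℝ → ℂ := fun t ↦ cexp (-(φ * I * (c + t * I))) * Gamma (c + t * I) with hW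
  set F : ℕ → ℝ → ℂ := fun n t ↦
    (a (n + 1) : ℂ) * (((A * (n + 1) : ℝ) : ℂ) ^ (-(c + t * I)) * W t) with hF
  have hpos : ∀ n : ℕ, 0 < A * ((n : ℝ) + 1) := fun n ↦ by positivity
  have hnorm : ∀ n t, ‖F n t‖ = |a (n + 1)| * (A * (n + 1)) ^ (-c) * ‖W t‖ := fun n t ↦ by
    simp only [hF]
    rw [norm_mul, norm_mul, norm_cpow_eq_rpow_re_of_pos (hpos n), norm_real, Real.norm_eq_abs,
      mul_assoc]
    simp
  have hWint : Integrable W := integrable_Gamma_mul_cexp_vertical hc0 hφ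
  have hFint : ∀ n, Integrable (F n) := fun n ↦ by
    refine (hWint.norm.const_mul (|a (n + 1)| * (A * (n + 1)) ^ (-c))).mono' ?_
      (.of_forall fun t ↦ (hnorm n t).le)
    refine (AEStronglyMeasurable.mul (Continuous.aestronglyMeasurable ?_) hWint.1).const_mul _
    exact Continuous.const_cpow (by fun_prop) (Or.inl (ofReal_ne_zero.mpr (hpos n).ne'))
  have hsum : Summable fun n ↦ ∫ t, ‖F n t‖ := by
    simp only [hnorm, integral_const_mul]
    exact (summable_norm_coeff_mul_rpow hA ha hc).mul_right _
  have hΛF : ∀ t : ℝ, Λ (c + t * I) * cexp (-(φ * I * (c + t * I))) = ∑' n, F n t := fun t ↦ by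
    rw [hΛ _ (by simp), mul_right_comm, ← tsum_mul_left]
    refine tsum_congr fun n ↦ ?_
    have hn : ((n : ℂ) + 1) = ((n + 1 : ℝ) : ℂ) := by push_cast; rfl
    simp only [hF, hW]
    rw [hn, ofReal_mul, mul_cpow_ofReal_nonneg hA.le (by positivity)]
    ring
  simp only [hΛF]
  rw [← (hasSum_integral_of_summable_integral_norm hFint hsum).tsum_eq, ← tsum_mul_left]
  refine tsum_congr fun n ↦ ?_
  simp only [hF, hW]
  rw [integral_const_mul, integral_cpow_mul_cexp_mul_Gamma_vertical hc0 hφ (hpos n)]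
  push_cast
  ring

theorem integral_Ioi_add_comp_neg {h : ℝ → ℂ} (hh : Integrable h) :
    ∫ t in Ioi (0 : ℝ), (h t + h (-t)) = ∫ t, h t := by
  rw [integral_add hh.integrableOn hh.comp_neg.integrableOn, integral_comp_neg_Ioi, neg_zero,
    ← setIntegral_union (Iic_disjoint_Ioi le_rfl).symm measurableSet_Iic hh.integrableOn
      hh.integrableOn, union_comm, Iic_union_Ioi, setIntegral_univ]

/-- In the Hecke-pair setup, for `0 < u < π/2`,
`∫₀^∞ R(t) cosh((π/2−u)t) dt
  = (π/2) e^{iπσ₀/2} e^{−iσ₀u} f(−e^{−iu}/√(4N)) + (π/2) e^{−iπσ₀/2} e^{iσ₀u} f(e^{iu}/√(4N))`,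
the integral converging absolutely. -/
theorem stmt_5 (k N : ℕ) (hk : 0 < k) (hN : 0 < N)
    (σ₀ : ℝ) (hσ₀ : σ₀ = (k : ℝ) / 2 + 1 / 4)
    (a a' : ℕ → ℝ) (C β : ℝ) (hC : 0 < C) (hβ : 0 < β)
    (ha : ∀ n : ℕ, |a n| ≤ C * (n : ℝ) ^ β)
    (ha' : ∀ n : ℕ, |a' n| ≤ C * (n : ℝ) ^ β)
    (Λ Λ' : ℂ → ℂ)
    (hΛdiff : Differentiable ℂ Λ) (hΛ'diff : Differentiable ℂ Λ')
    (hΛ : ∀ s : ℂ, β + 1 < s.re →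
      Λ s = ((2 * Real.pi / Real.sqrt (4 * (N : ℝ)) : ℝ) : ℂ) ^ (-s) * Complex.Gamma s *
        ∑' n : ℕ, (a (n + 1) : ℂ) * ((n : ℂ) + 1) ^ (-s))
    (hΛ' : ∀ s : ℂ, β + 1 < s.re →
      Λ' s = ((2 * Real.pi / Real.sqrt (4 * (N : ℝ)) : ℝ) : ℂ) ^ (-s) * Complex.Gamma s *
        ∑' n : ℕ, (a' (n + 1) : ℂ) * ((n : ℂ) + 1) ^ (-s))
    (hFE : ∀ s : ℂ, Λ s = Λ' ((k : ℂ) + 1 / 2 - s))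
    (hstrip : ∀ σ₁ σ₂ : ℝ, ∃ C' B : ℝ, ∀ σ t : ℝ, σ₁ ≤ σ → σ ≤ σ₂ →
      ‖Λ ((σ : ℂ) + (t : ℂ) * Complex.I)‖ +
        ‖Λ' ((σ : ℂ) + (t : ℂ) * Complex.I)‖ ≤
          C' * (1 + |t|) ^ B * Real.exp (-Real.pi * |t| / 2))
    (R : ℝ → ℂ)
    (hR : ∀ t : ℝ, R t =
      (Λ ((σ₀ : ℂ) + (t : ℂ) * Complex.I) + Λ' ((σ₀ : ℂ) + (t : ℂ) * Complex.I)) / 2)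
    (u : ℝ) (hu1 : 0 < u) (hu2 : u < Real.pi / 2) :
    MeasureTheory.IntegrableOn
      (fun t : ℝ => R t * (Real.cosh ((Real.pi / 2 - u) * t) : ℂ)) (Set.Ioi 0) ∧
    ∫ t in Set.Ioi (0 : ℝ), R t * (Real.cosh ((Real.pi / 2 - u) * t) : ℂ) =
      (Real.pi / 2 : ℂ) * Complex.exp (Complex.I * Real.pi * σ₀ / 2) *
          Complex.exp (-Complex.I * σ₀ * u) *
          heckeSum a (-Complex.exp (-Complex.I * u) / (Real.sqrt (4 * (N : ℝ)) : ℂ)) +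
      (Real.pi / 2 : ℂ) * Complex.exp (-Complex.I * Real.pi * σ₀ / 2) *
          Complex.exp (Complex.I * σ₀ * u) *
          heckeSum a (Complex.exp (Complex.I * u) / (Real.sqrt (4 * (N : ℝ)) : ℂ)) := by
  set A : ℝ := 2 * Real.pi / Real.sqrt (4 * (N : ℝ)) with hAdef
  have hsqrt : 0 < Real.sqrt (4 * (N : ℝ)) := by positivity
  have hA : 0 < A := by positivity
  set c : ℝ := max (β + 2) σ₀
  have hcβ : β + 1 < c := (by linarith : β + 1 < β + 2).trans_le (le_max_left _ _)
  have hvert : ∀ φ : ℝ, |φ| < Real.pi / 2 →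
      Integrable (fun t : ℝ ↦ Λ (σ₀ + t * I) * cexp (-(φ * I * (σ₀ + t * I)))) ∧
      ∫ t : ℝ, Λ (σ₀ + t * I) * cexp (-(φ * I * (σ₀ + t * I))) =
        2 * Real.pi * ∑' n : ℕ, (a (n + 1) : ℂ) * cexp (-(cexp (φ * I) * (A * (n + 1)))) := by
    intro φ hφ
    obtain ⟨C', B, hB⟩ := hstrip σ₀ c
    obtain ⟨M, δ, hδ, hM⟩ := exists_norm_mul_cexp_strip_le (Λ := Λ) hφ fun σ t h₁ h₂ ↦
      (le_add_of_nonneg_right (norm_nonneg _)).trans (hB σ t h₁ h₂)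
    have hg : Differentiable ℂ fun s ↦ Λ s * cexp (-(φ * I * s)) := by fun_prop
    refine ⟨integrable_vertical_of_norm_le (g := fun s ↦ Λ s * cexp (-(φ * I * s))) hδ
      (hg.continuous.comp (by fun_prop)) fun t ↦ hM σ₀ t le_rfl (le_max_right _ _), ?_⟩
    rw [integral_vertical_eq_of_norm_le hg (le_max_right (β + 2) σ₀) hδ hM]
    exact integral_completed_dirichlet_vertical hA ha hcβ (by linarith) hφ fun s hs ↦
      hΛ s (hs ▸ hcβ)
  set θ : ℝ := Real.pi / 2 - u with hθ
  have hθabs : |θ| < Real.pi / 2 := abs_lt.mpr ⟨by linarith, by linarith⟩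
  obtain ⟨hint₁, hval₁⟩ := hvert θ hθabs
  obtain ⟨hint₂, hval₂⟩ := hvert (-θ) (by rwa [abs_neg])
  set h : ℝ → ℂ := fun t ↦ Λ (σ₀ + t * I) * (Real.cosh (θ * t) : ℂ) / 2 with hh
  have hdecomp : h = fun t : ℝ ↦
      cexp (I * θ * σ₀) / 4 * (Λ (σ₀ + t * I) * cexp (-(θ * I * (σ₀ + t * I)))) +
      cexp (-(I * θ * σ₀)) / 4 *
        (Λ (σ₀ + t * I) * cexp (-((-θ : ℝ) * I * (σ₀ + t * I)))) := by
    funext t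
    have e₁ : -(θ * I * (σ₀ + t * I)) = -(I * θ * σ₀) + θ * t := by
      linear_combination (-(θ * t) : ℂ) * I_sq
    have e₂ : -((-θ : ℝ) * I * (σ₀ + t * I)) = I * θ * σ₀ + -(θ * t) := by
      push_cast
      linear_combination (θ * t : ℂ) * I_sq
    have e₃ : cexp (I * θ * σ₀) * cexp (-(I * θ * σ₀)) = 1 := by
      rw [← Complex.exp_add, add_neg_cancel, Complex.exp_zero]
    simp only [hh]
    rw [e₁, e₂, Complex.exp_add, Complex.exp_add, ofReal_cosh, Complex.cosh, ofReal_mul]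
    linear_combination (-(Λ (σ₀ + t * I) * (cexp (θ * t) + cexp (-(θ * t)))) / 4) * e₃
  have hint : Integrable h := by
    rw [hdecomp]
    exact (hint₁.const_mul _).add (hint₂.const_mul _)
  have hRh : (fun t : ℝ ↦ R t * (Real.cosh (θ * t) : ℂ)) = fun t ↦ h t + h (-t) := by
    funext t
    have hΛ't : Λ' (σ₀ + t * I) = Λ (σ₀ + (-t : ℝ) * I) := by
      rw [hFE, hσ₀]
      congr 1
      push_cast
      ring
    simp only [hh, hR, hΛ't, mul_neg, Real.cosh_neg]
    ring
  rw [hRh]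
  refine ⟨(hint.add hint.comp_neg).integrableOn, ?_⟩
  have hsum₁ : ∑' n : ℕ, (a (n + 1) : ℂ) * cexp (-(cexp (θ * I) * (A * (n + 1)))) =
      heckeSum a (-cexp (-I * u) / (Real.sqrt (4 * (N : ℝ)) : ℂ)) := by
    have hexp : cexp (θ * I) = I * cexp (-I * u) := by
      rw [show (θ : ℂ) * I = Real.pi / 2 * I + -I * u by rw [hθ]; push_cast; ring,
        Complex.exp_add, exp_pi_div_two_mul_I]
    refine tsum_congr fun n ↦ ?_
    rw [hexp, hAdef]
    push_cast
    ring_nf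
  have hsum₂ : ∑' n : ℕ, (a (n + 1) : ℂ) * cexp (-(cexp ((-θ : ℝ) * I) * (A * (n + 1)))) =
      heckeSum a (cexp (I * u) / (Real.sqrt (4 * (N : ℝ)) : ℂ)) := by
    have hexp : cexp ((-θ : ℝ) * I) = -I * cexp (I * u) := by
      rw [show ((-θ : ℝ) : ℂ) * I = -Real.pi / 2 * I + I * u by rw [hθ]; push_cast; ring,
        Complex.exp_add, exp_neg_pi_div_two_mul_I]
    refine tsum_congr fun n ↦ ?_
    rw [hexp, hAdef]
    push_cast
    ring_nf
  have hphase₁ : cexp (I * θ * σ₀) = cexp (I * Real.pi * σ₀ / 2) * cexp (-I * σ₀ * u) := by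
    rw [hθ, ← Complex.exp_add]
    push_cast
    ring_nf
  have hphase₂ : cexp (-(I * θ * σ₀)) = cexp (-I * Real.pi * σ₀ / 2) * cexp (I * σ₀ * u) := by
    rw [hθ, ← Complex.exp_add]
    push_cast
    ring_nf
  rw [integral_Ioi_add_comp_neg hint, hdecomp,
    integral_add (hint₁.const_mul _) (hint₂.const_mul _), integral_const_mul, integral_const_mul,
    hval₁, hval₂, hsum₁, hsum₂, hphase₁, hphase₂]
  ring
end

section
/- Let k, N, r be positive integers, let b : ℕ → ℂ satisfy |b(n)| ≤ C n^α for some C, α > 0, and let c ≥ 1 be the smallest positive integer with b(c) ≠ 0. For Im(z) > 0 set g(z) = ∑_{n≥c} b(n) e^{2πinz/r}. Then there exists a constant C′ > 0 such that for every u₀ with 0 < u₀ < π/2 and every w ∈ ℂ with |w − u₀| ≤ u₀/2, the point z_w := −1/(√(4N)(e^{iw} − 1)) lies in the upper half-plane and |(e^{iw}/(e^{iw} − 1))^{k + 1/2} · g(z_w)| ≤ C′ · u₀^{−(k + 1/2)} · e^{−A/u₀}, where A = 2 c e^{−π²/96} / (9 r √N). -/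
/-- A linear lower bound for the sine on `[0, 3π/4]`. -/
theorem div_two_pi_le_sin {u : ℝ} (hu : 0 ≤ u) (hu' : u ≤ 3 * Real.pi / 4) :
    u / (2 * Real.pi) ≤ Real.sin u := by
  have hpi := Real.pi_pos
  have h1 : 2 / Real.pi * (u / 2) ≤ Real.sin (u / 2) :=
    Real.mul_le_sin (by linarith) (by linarith)
  have h2 : 1 - 2 / Real.pi * (u / 2) ≤ Real.cos (u / 2) :=
    Real.one_sub_mul_le_cos (by linarith) (by linarith)
  have h3 : 2 / Real.pi * (u / 2) = u / Real.pi := by ring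
  rw [h3] at h1 h2
  have h4 : u / Real.pi ≤ 3 / 4 := by
    rw [div_le_iff₀ hpi]; linarith
  have h5 : 0 ≤ u / Real.pi := by positivity
  have h6 : Real.sin u = 2 * Real.sin (u / 2) * Real.cos (u / 2) := by
    rw [← Real.sin_two_mul]; congr 1; ring
  have h7 : u / (2 * Real.pi) = 2 * (u / Real.pi) * (1 / 4) := by field_simp; norm_num
  rw [h6, h7]
  gcongr <;> linarith

theorem cosh_sub_cos_le {u v u₀ : ℝ} (hu₀ : 0 < u₀) (hu₀' : u₀ < Real.pi / 2)
    (h : (u - u₀) ^ 2 + v ^ 2 ≤ (u₀ / 2) ^ 2) :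
    Real.cosh v - Real.cos u ≤ 9 / 8 * (u * u₀) := by
  have hpi := Real.pi_lt_d2
  have hcos := Real.one_sub_sq_div_two_le_cos (x := u)
  have hv : v ^ 2 / 2 ≤ 1 / 3 := by nlinarith [sq_nonneg (u - u₀)]
  have hcosh : Real.cosh v ≤ 1 + 3 / 2 * (v ^ 2 / 2) := by
    refine (Real.cosh_le_exp_half_sq v).trans ?_
    have h1 := Real.add_one_le_exp (-(v ^ 2 / 2))
    have h2 : Real.exp (v ^ 2 / 2) * Real.exp (-(v ^ 2 / 2)) = 1 := by
      rw [← Real.exp_add]; simp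
    have h3 := Real.exp_pos (v ^ 2 / 2)
    have h0 : 0 ≤ v ^ 2 / 2 := by positivity
    generalize v ^ 2 / 2 = t at *
    have h4 : Real.exp t * (1 - t) ≤ 1 := by nlinarith
    have h5 : 1 ≤ (1 + 3 / 2 * t) * (1 - t) := by nlinarith
    exact le_of_mul_le_mul_right (h4.trans h5) (by linarith)
  have hle := (abs_le_of_sq_le_sq' (a := u - u₀) (b := u₀ / 2)
    (by linarith [sq_nonneg v]) (by linarith)).2
  nlinarith [sq_nonneg u, mul_nonneg hu₀.le (sub_nonneg.2 hle)]

/-- The imaginary part of the Cayley-type transform `w ↦ -1 / (s (e^{iw} - 1))`. -/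
theorem im_neg_one_div_mul_exp_sub_one (s : ℝ) (w : ℂ)
    (h : 0 < Real.cosh w.im - Real.cos w.re) :
    (-1 / ((s : ℂ) * (Complex.exp (Complex.I * w) - 1))).im =
      Real.sin w.re / (2 * (Real.cosh w.im - Real.cos w.re)) / s := by
  have hre : (Complex.exp (Complex.I * w) - 1).re =
      Real.exp (-w.im) * Real.cos w.re - 1 := by simp [Complex.exp_re]
  have him : (Complex.exp (Complex.I * w) - 1).im =
      Real.exp (-w.im) * Real.sin w.re := by simp [Complex.exp_im]
  have hn : Complex.normSq (Complex.exp (Complex.I * w) - 1) =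
      Real.exp (-w.im) * (2 * (Real.cosh w.im - Real.cos w.re)) := by
    rw [Complex.normSq_apply, hre, him, Real.cosh_eq]
    have h1 : Real.exp (-w.im) * Real.exp w.im = 1 := by rw [← Real.exp_add]; simp
    linear_combination Real.exp (-w.im) ^ 2 * Real.sin_sq_add_cos_sq w.re - h1
  have h2 : -1 / ((s : ℂ) * (Complex.exp (Complex.I * w) - 1)) =
      ((s⁻¹ : ℝ) : ℂ) * -(Complex.exp (Complex.I * w) - 1)⁻¹ := by
    rw [Complex.ofReal_inv, neg_div, one_div, mul_inv, mul_neg]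
  rw [h2, Complex.im_ofReal_mul, Complex.neg_im, Complex.inv_im, hn, him]
  have := Real.exp_pos (-w.im)
  field_simp

/-- On the disc `|w - u₀| ≤ u₀ / 2` the transform `-1 / (s (e^{iw} - 1))` has imaginary part
at least a constant multiple of `1 / u₀`. -/
theorem le_im_neg_one_div_mul_exp_sub_one {s u₀ : ℝ} {w : ℂ} (hs : 0 < s) (hu₀ : 0 < u₀)
    (hu₀' : u₀ < Real.pi / 2) (hw : ‖w - u₀‖ ≤ u₀ / 2) :
    2 / (9 * Real.pi * u₀) / s ≤
      (-1 / ((s : ℂ) * (Complex.exp (Complex.I * w) - 1))).im := by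
  have hpi := Real.pi_pos
  have hre := (Complex.abs_re_le_norm _).trans hw
  simp only [Complex.sub_re, Complex.ofReal_re, abs_le] at hre
  have hu : 0 < w.re := by linarith
  have hdisc : (w.re - u₀) ^ 2 + w.im ^ 2 ≤ (u₀ / 2) ^ 2 := by
    have h1 := pow_le_pow_left₀ (norm_nonneg _) hw 2
    rw [Complex.sq_norm, Complex.normSq_apply] at h1
    simp only [Complex.sub_re, Complex.sub_im, Complex.ofReal_re, Complex.ofReal_im] at h1
    linarith
  have hsin := div_two_pi_le_sin hu.le (by linarith)
  have hle := cosh_sub_cos_le hu₀ hu₀' hdisc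
  have hpos : 0 < Real.cosh w.im - Real.cos w.re := by
    have h1 := Real.one_le_cosh w.im
    have h2 : Real.cos w.re < Real.cos 0 :=
      Real.cos_lt_cos_of_nonneg_of_le_pi le_rfl (by linarith) hu
    rw [Real.cos_zero] at h2
    linarith
  rw [im_neg_one_div_mul_exp_sub_one s w hpos]
  have h3 : 2 / (9 * Real.pi * u₀) =
      w.re / (2 * Real.pi) / (2 * (9 / 8 * (w.re * u₀))) := by
    field_simp; norm_num
  rw [h3]
  gcongr
  exact (div_nonneg hu.le (by positivity)).trans hsin

theorem norm_exp_div_exp_sub_one_le {u₀ : ℝ} {w : ℂ} (hu₀ : 0 < u₀)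
    (hu₀' : u₀ < Real.pi / 2) (hw : ‖w - u₀‖ ≤ u₀ / 2) :
    ‖Complex.exp (Complex.I * w) / (Complex.exp (Complex.I * w) - 1)‖ ≤
      4 * Real.pi * Real.exp Real.pi * u₀⁻¹ := by
  have hpi := Real.pi_pos
  have hre := (Complex.abs_re_le_norm _).trans hw
  simp only [Complex.sub_re, Complex.ofReal_re, abs_le] at hre
  have him := (Complex.abs_im_le_norm _).trans hw
  simp only [Complex.sub_im, Complex.ofReal_im, abs_le] at him
  have hsin := div_two_pi_le_sin (u := w.re) (by linarith) (by linarith)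
  have h1 : Real.exp (-w.im) * (u₀ / (4 * Real.pi)) ≤ ‖Complex.exp (Complex.I * w) - 1‖ := by
    have h2 : (Complex.exp (Complex.I * w) - 1).im =
        Real.exp (-w.im) * Real.sin w.re := by simp [Complex.exp_im]
    refine le_trans ?_ ((le_abs_self _).trans (Complex.abs_im_le_norm _))
    rw [h2]
    gcongr
    refine le_trans ?_ hsin
    rw [div_le_div_iff₀ (by positivity) (by positivity)]
    nlinarith
  have h3 : ‖Complex.exp (Complex.I * w)‖ = Real.exp (-w.im) := by
    rw [Complex.norm_exp]; simp
  have h4 := Real.exp_pos (-w.im)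
  rw [norm_div, h3, div_le_iff₀ (lt_of_lt_of_le (by positivity) h1)]
  have h5 : (1 : ℝ) ≤ Real.exp Real.pi := Real.one_le_exp hpi.le
  calc Real.exp (-w.im) = 4 * Real.pi * 1 * u₀⁻¹ *
        (Real.exp (-w.im) * (u₀ / (4 * Real.pi))) := by field_simp
    _ ≤ _ := by gcongr

theorem summable_natCast_add_rpow_mul_exp_neg (c : ℕ) (hc : 1 ≤ c) (α : ℝ) {β : ℝ}
    (hβ : 0 < β) :
    Summable fun n : ℕ => ((n + c : ℕ) : ℝ) ^ α * Real.exp (-β * n) := by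
  have h1 := ((summable_nat_add_iff c).2
    (Real.summable_pow_mul_exp_neg_nat_mul ⌈α⌉₊ hβ)).mul_right (Real.exp (β * c))
  refine Summable.of_nonneg_of_le (fun n => by positivity) (fun n => ?_) h1
  have h2 : (1 : ℝ) ≤ ((n + c : ℕ) : ℝ) := by exact_mod_cast (by omega)
  have h3 : Real.exp (-β * n) = Real.exp (-β * (n + c : ℕ)) * Real.exp (β * c) := by
    rw [← Real.exp_add]; congr 1; push_cast; ring
  rw [h3, ← mul_assoc, ← Real.rpow_natCast]
  gcongr
  exact Nat.le_ceil α

/-- A `q`-expansion starting at index `c`, with coefficients of polynomial growth, decays like its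
leading term. -/
theorem norm_tsum_exp_le {r : ℕ} {b : ℕ → ℂ} {C α : ℝ} (hC : 0 < C)
    (hb : ∀ n : ℕ, 1 ≤ n → ‖b n‖ ≤ C * (n : ℝ) ^ α) {c : ℕ} (hc : 1 ≤ c)
    {β t : ℝ} (hβ : 0 < β) (hβt : β ≤ t) {z : ℂ} (hz : t ≤ 2 * Real.pi * z.im / r) :
    ‖∑' n : ℕ, b (n + c) *
        Complex.exp (2 * Real.pi * Complex.I * ((n : ℂ) + (c : ℂ)) * z / (r : ℂ))‖ ≤
      C * (∑' n : ℕ, ((n + c : ℕ) : ℝ) ^ α * Real.exp (-β * n)) * Real.exp (-(c * t)) := by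
  have hs := ((summable_natCast_add_rpow_mul_exp_neg c hc α hβ).hasSum.mul_left C).mul_right
    (Real.exp (-(c * t)))
  refine tsum_of_norm_bounded hs fun n => ?_
  have h1 : (2 * Real.pi * Complex.I * ((n : ℂ) + (c : ℂ)) * z / (r : ℂ)).re =
      -((n + c) * (2 * Real.pi * z.im / r)) := by
    have : 2 * Real.pi * Complex.I * ((n : ℂ) + (c : ℂ)) * z / (r : ℂ) =
        ((2 * Real.pi * (n + c) / r : ℝ) : ℂ) * (Complex.I * z) := by push_cast; ring
    rw [this, Complex.re_ofReal_mul]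
    simp only [Complex.mul_re, Complex.I_re, Complex.I_im]
    ring
  rw [norm_mul, Complex.norm_exp, h1, mul_assoc C,
    mul_assoc (_ ^ α), ← Real.exp_add, ← mul_assoc C]
  gcongr
  · exact hb _ (by omega)
  · have h2 : (n : ℝ) * β ≤ n * (2 * Real.pi * z.im / r) := by gcongr; linarith
    have h3 : (c : ℝ) * t ≤ c * (2 * Real.pi * z.im / r) := by gcongr
    linarith

/-- bound for the slashed cusp-form-like sum near the real segment `(0, π/2)`. -/
theorem stmt_7 (k N r : ℕ) (hk : 0 < k) (hN : 0 < N) (hr : 0 < r)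
    (b : ℕ → ℂ) (C α : ℝ) (hC : 0 < C) (hα : 0 < α)
    (hb : ∀ n : ℕ, 1 ≤ n → norm (b n) ≤ C * (n : ℝ) ^ α)
    (c : ℕ) (hc : 1 ≤ c) (hbc : b c ≠ 0)
    (hmin : ∀ m : ℕ, 1 ≤ m → m < c → b m = 0) :
    ∃ C' > (0 : ℝ), ∀ u₀ : ℝ, 0 < u₀ → u₀ < Real.pi / 2 →
      ∀ w : ℂ, norm (w - (u₀ : ℂ)) ≤ u₀ / 2 →
        0 < (-1 / ((Real.sqrt (4 * (N : ℝ)) : ℂ) * (Complex.exp (Complex.I * w) - 1))).im ∧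
        norm
            ((Complex.exp (Complex.I * w) / (Complex.exp (Complex.I * w) - 1)) ^
                ((k : ℂ) + 1 / 2) *
              ∑' n : ℕ, b (n + c) *
                Complex.exp (2 * Real.pi * Complex.I * ((n : ℂ) + (c : ℂ)) *
                  (-1 / ((Real.sqrt (4 * (N : ℝ)) : ℂ) * (Complex.exp (Complex.I * w) - 1))) /
                    (r : ℂ))) ≤
          C' * u₀ ^ (-((k : ℝ) + 1 / 2)) *
            Real.exp (-(2 * (c : ℝ) * Real.exp (-Real.pi ^ 2 / 96) /
              (9 * (r : ℝ) * Real.sqrt (N : ℝ))) / u₀) := by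
  have hpi := Real.pi_pos
  have hN' : (0 : ℝ) < N := by exact_mod_cast hN
  have hr' : (0 : ℝ) < r := by exact_mod_cast hr
  have hs : 0 < Real.sqrt (4 * (N : ℝ)) := Real.sqrt_pos.2 (by positivity)
  have hs' : Real.sqrt (4 * (N : ℝ)) = 2 * Real.sqrt N := by
    rw [Real.sqrt_mul (by norm_num), show (4 : ℝ) = 2 ^ 2 by norm_num,
      Real.sqrt_sq (by norm_num)]
  have hsN : 0 < Real.sqrt (N : ℝ) := Real.sqrt_pos.2 hN'
  set B : ℝ := 2 / (9 * r * Real.sqrt N) with hB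
  have hBpos : 0 < B := by positivity
  set S : ℝ := ∑' n : ℕ, ((n + c : ℕ) : ℝ) ^ α * Real.exp (-(B / 2) * n) with hS
  have hSpos : 0 ≤ S := tsum_nonneg fun n => by positivity
  refine ⟨(4 * Real.pi * Real.exp Real.pi) ^ ((k : ℝ) + 1 / 2) * (C * S + 1),
    by positivity, fun u₀ hu₀ hu₀' w hw => ?_⟩
  have him := le_im_neg_one_div_mul_exp_sub_one hs hu₀ hu₀' hw
  refine ⟨lt_of_lt_of_le (by positivity) him, ?_⟩
  have hβt : B / 2 ≤ B / u₀ := by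
    gcongr
    linarith [Real.pi_lt_d2]
  have hz : B / u₀ ≤ 2 * Real.pi *
      (-1 / ((Real.sqrt (4 * (N : ℝ)) : ℂ) * (Complex.exp (Complex.I * w) - 1))).im / r := by
    calc B / u₀ = 2 * Real.pi * (2 / (9 * Real.pi * u₀) / Real.sqrt (4 * (N : ℝ))) / r := by
          rw [hB, hs']; field_simp
      _ ≤ _ := by gcongr
  have hsum := norm_tsum_exp_le hC hb hc (half_pos hBpos) hβt hz
  have hpow : ‖(Complex.exp (Complex.I * w) / (Complex.exp (Complex.I * w) - 1)) ^
      ((k : ℂ) + 1 / 2)‖ ≤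
      (4 * Real.pi * Real.exp Real.pi) ^ ((k : ℝ) + 1 / 2) * u₀ ^ (-((k : ℝ) + 1 / 2)) := by
    rw [show (k : ℂ) + 1 / 2 = (((k : ℝ) + 1 / 2 : ℝ) : ℂ) by push_cast; rfl,
      Complex.norm_cpow_real, Real.rpow_neg hu₀.le, ← Real.inv_rpow hu₀.le,
      ← Real.mul_rpow (by positivity) (by positivity)]
    gcongr
    exact norm_exp_div_exp_sub_one_le hu₀ hu₀' hw
  have hexp : Real.exp (-(c * (B / u₀))) ≤
      Real.exp (-(2 * (c : ℝ) * Real.exp (-Real.pi ^ 2 / 96) /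
        (9 * (r : ℝ) * Real.sqrt (N : ℝ))) / u₀) := by
    have h1 : Real.exp (-Real.pi ^ 2 / 96) ≤ 1 := Real.exp_le_one_iff.2 (by
      have := sq_nonneg Real.pi
      linarith)
    have h2 : -(2 * (c : ℝ) * Real.exp (-Real.pi ^ 2 / 96) /
        (9 * (r : ℝ) * Real.sqrt (N : ℝ))) / u₀ =
        -(c * (B / u₀) * Real.exp (-Real.pi ^ 2 / 96)) := by
      rw [hB]; ring
    rw [h2]
    exact Real.exp_le_exp.2 (neg_le_neg (mul_le_of_le_one_right (by positivity) h1))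
  rw [norm_mul]
  calc _ ≤ (4 * Real.pi * Real.exp Real.pi) ^ ((k : ℝ) + 1 / 2) * u₀ ^ (-((k : ℝ) + 1 / 2)) *
        ((C * S + 1) * Real.exp (-(2 * (c : ℝ) * Real.exp (-Real.pi ^ 2 / 96) /
          (9 * (r : ℝ) * Real.sqrt (N : ℝ))) / u₀)) := by
        refine mul_le_mul hpow (hsum.trans ?_) (norm_nonneg _) (by positivity)
        exact mul_le_mul (by linarith) hexp (by positivity) (by positivity)
    _ = _ := by ring
end

section
/- Let k, N, r be positive integers, let b : ℕ → ℂ satisfy |b(n)| ≤ C n^α for some C, α > 0, and let c ≥ 1 be the smallest positive integer with b(c) ≠ 0. For Im(z) > 0 set g(z) = ∑_{n≥c} b(n) e^{2πinz/r}, and define the holomorphic function H(w) = (e^{iw}/(e^{iw} − 1))^{k + 1/2} · g(−1/(√(4N)(e^{iw} − 1))) on a complex neighbourhood of the real interval (0, π/2). Then there exists a constant C′ > 0 such that for every integer p ≥ 0 and every u with 0 < u < π/2, |H^{(p)}(u)| ≤ C′ · 2^p · p! · u^{−(p + k + 1/2)} · e^{−A/u}, where A = 2 c e^{−π²/96} /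 (9 r √N). -/
/-- The function `H(w) = (e^{iw}/(e^{iw}−1))^{k+1/2} · g(−1/(√(4N)(e^{iw}−1)))`, where
`g(z) = ∑_{n≥c} b(n) e^{2πinz/r}`. -/
noncomputable def slashFun (k N r c : ℕ) (b : ℕ → ℂ) (w : ℂ) : ℂ :=
  (Complex.exp (Complex.I * w) / (Complex.exp (Complex.I * w) - 1)) ^ ((k : ℂ) + 1 / 2) *
    ∑' n : ℕ, b (n + c) *
      Complex.exp (2 * Real.pi * Complex.I * ((n : ℂ) + (c : ℂ)) *
        (-1 / ((Real.sqrt (4 * (N : ℝ)) : ℂ) * (Complex.exp (Complex.I * w) - 1))) / (r : ℂ))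

/-- The shifted `q`-series `∑_{n ≥ c} b(n) e^{2πinz/r}`. -/
noncomputable def shiftedQSeries (r c : ℕ) (b : ℕ → ℂ) (z : ℂ) : ℂ :=
  ∑' n : ℕ, b (n + c) *
    Complex.exp (2 * Real.pi * Complex.I * ((n : ℂ) + (c : ℂ)) * z / (r : ℂ))

theorem norm_qSeries_term (r n c : ℕ) (a z : ℂ) :
    ‖a * Complex.exp (2 * Real.pi * Complex.I * ((n : ℂ) + (c : ℂ)) * z / (r : ℂ))‖ =
      ‖a‖ * Real.exp (-(2 * Real.pi * z.im / r) * ((n + c : ℕ) : ℝ)) := by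
  rw [norm_mul, Complex.norm_exp]
  congr 2
  have h : 2 * Real.pi * Complex.I * ((n : ℂ) + (c : ℂ)) * z / (r : ℂ) =
      ((2 * Real.pi * (n + c) / r : ℝ) : ℂ) * (Complex.I * z) := by
    push_cast
    ring
  rw [h, Complex.re_ofReal_mul, Complex.I_mul_re]
  push_cast
  ring

theorem summable_norm_mul_exp_neg_of_le_rpow {b : ℕ → ℂ} {C α : ℝ}
    (hb : ∀ n : ℕ, 1 ≤ n → ‖b n‖ ≤ C * (n : ℝ) ^ α) {c : ℕ} (hc : 1 ≤ c) {t : ℝ} (ht : 0 < t) :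
    Summable fun n : ℕ => ‖b (n + c)‖ * Real.exp (-t * ((n + c : ℕ) : ℝ)) := by
  have hs := (summable_nat_add_iff c).2
    ((Real.summable_pow_mul_exp_neg_nat_mul ⌈α⌉₊ ht).mul_left |C|)
  refine Summable.of_nonneg_of_le (fun n => by positivity) (fun n => ?_) hs
  have h1 : (1 : ℝ) ≤ ((n + c : ℕ) : ℝ) := by exact_mod_cast (by omega : 1 ≤ n + c)
  rw [← mul_assoc]
  gcongr
  calc ‖b (n + c)‖ ≤ C * ((n + c : ℕ) : ℝ) ^ α := hb _ (by omega)
    _ ≤ |C| * ((n + c : ℕ) : ℝ) ^ (⌈α⌉₊ : ℝ) := by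
        gcongr
        · exact le_abs_self C
        · exact Nat.le_ceil α
    _ = _ := by rw [Real.rpow_natCast]

theorem differentiableAt_shiftedQSeries {r : ℕ} (hr : 0 < r) {b : ℕ → ℂ} {C α : ℝ}
    (hb : ∀ n : ℕ, 1 ≤ n → ‖b n‖ ≤ C * (n : ℝ) ^ α) {c : ℕ} (hc : 1 ≤ c) {z : ℂ}
    (hz : 0 < z.im) : DifferentiableAt ℂ (shiftedQSeries r c b) z := by
  have hU : IsOpen {v : ℂ | z.im / 2 < v.im} :=
    isOpen_lt continuous_const Complex.continuous_im
  have hr' : (0 : ℝ) < r := by exact_mod_cast hr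
  have ht : 0 < 2 * Real.pi * (z.im / 2) / r := by positivity
  refine (Complex.differentiableOn_tsum_of_summable_norm
    (summable_norm_mul_exp_neg_of_le_rpow hb hc ht) (fun n => ?_) hU
    (fun n v hv => ?_)).differentiableAt (hU.mem_nhds (half_lt_self hz))
  · fun_prop
  · rw [norm_qSeries_term]
    have hv' : z.im / 2 ≤ v.im := le_of_lt hv
    gcongr

theorem norm_shiftedQSeries_le {r : ℕ} {b : ℕ → ℂ} {C α : ℝ}
    (hb : ∀ n : ℕ, 1 ≤ n → ‖b n‖ ≤ C * (n : ℝ) ^ α) {c : ℕ} (hc : 1 ≤ c) {s t : ℝ}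
    (hs : 0 ≤ s) (ht : 0 < t) {z : ℂ} (hz : s + t ≤ 2 * Real.pi * z.im / r) :
    ‖shiftedQSeries r c b z‖ ≤
      Real.exp (-s * c) * ∑' n : ℕ, ‖b (n + c)‖ * Real.exp (-t * ((n + c : ℕ) : ℝ)) := by
  refine tsum_of_norm_bounded
    ((summable_norm_mul_exp_neg_of_le_rpow hb hc ht).hasSum.mul_left _) fun n => ?_
  rw [norm_qSeries_term, mul_left_comm, ← Real.exp_add]
  gcongr
  have hn : (0 : ℝ) ≤ n := n.cast_nonneg
  have hc' : (0 : ℝ) ≤ c := c.cast_nonneg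
  push_cast
  nlinarith [mul_le_mul_of_nonneg_right hz (add_nonneg hn hc'), mul_nonneg hs hn]

theorem normSq_exp_I_mul_sub_one (w : ℂ) :
    Complex.normSq (Complex.exp (Complex.I * w) - 1) =
      2 * Real.exp (-w.im) * (Real.cosh w.im - Real.cos w.re) := by
  rw [Complex.normSq_apply, Complex.sub_re, Complex.sub_im, Complex.exp_re, Complex.exp_im,
    Complex.I_mul_re, Complex.I_mul_im, Complex.one_re, Complex.one_im, Real.cosh_eq]
  have h : Real.exp (-w.im) * Real.exp w.im = 1 := by rw [← Real.exp_add]; simp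
  linear_combination Real.exp (-w.im) ^ 2 * Real.sin_sq_add_cos_sq w.re - h

theorem im_neg_inv_exp_I_mul_sub_one (w : ℂ) :
    (-(Complex.exp (Complex.I * w) - 1)⁻¹).im =
      Real.sin w.re / (2 * (Real.cosh w.im - Real.cos w.re)) := by
  rw [Complex.neg_im, Complex.inv_im, normSq_exp_I_mul_sub_one, Complex.sub_im, Complex.exp_im,
    Complex.I_mul_re, Complex.I_mul_im, Complex.one_im, neg_div, neg_neg, sub_zero, mul_right_comm,
    mul_comm _ (Real.exp (-w.im)), mul_div_mul_left _ _ (Real.exp_ne_zero _)]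

theorem cosh_sub_cos_pos {x : ℝ} (y : ℝ) (hx0 : 0 < x) (hx : x < Real.pi) :
    0 < Real.cosh y - Real.cos x := by
  have h := Real.cos_lt_cos_of_nonneg_of_le_pi le_rfl hx.le hx0
  rw [Real.cos_zero] at h
  linarith [Real.one_le_cosh y]

theorem im_neg_inv_exp_I_mul_sub_one_pos {w : ℂ} (hw0 : 0 < w.re) (hw : w.re < Real.pi) :
    0 < (-(Complex.exp (Complex.I * w) - 1)⁻¹).im := by
  rw [im_neg_inv_exp_I_mul_sub_one]
  have h1 := Real.sin_pos_of_pos_of_lt_pi hw0 hw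
  have h2 := cosh_sub_cos_pos w.im hw0 hw
  positivity

theorem exp_I_mul_sub_one_ne_zero {w : ℂ} (hw0 : 0 < w.re) (hw : w.re < Real.pi) :
    Complex.exp (Complex.I * w) - 1 ≠ 0 := by
  intro h
  have := im_neg_inv_exp_I_mul_sub_one_pos hw0 hw
  simp [h] at this

theorem slashFun_eq (k N r c : ℕ) (b : ℕ → ℂ) (w : ℂ) :
    slashFun k N r c b w =
      (Complex.exp (Complex.I * w) / (Complex.exp (Complex.I * w) - 1)) ^ ((k : ℂ) + 1 / 2) *
        shiftedQSeries r c b (((Real.sqrt (4 * (N : ℝ)))⁻¹ : ℝ) *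
          -(Complex.exp (Complex.I * w) - 1)⁻¹) := by
  have h : ((Real.sqrt (4 * (N : ℝ)))⁻¹ : ℝ) * -(Complex.exp (Complex.I * w) - 1)⁻¹ =
      -1 / ((Real.sqrt (4 * (N : ℝ)) : ℂ) * (Complex.exp (Complex.I * w) - 1)) := by
    rw [div_eq_mul_inv, mul_inv]
    push_cast
    ring
  rw [h]
  rfl

theorem differentiableAt_slashFun (k : ℕ) {N r : ℕ} (hN : 0 < N) (hr : 0 < r) {b : ℕ → ℂ}
    {C α : ℝ} (hb : ∀ n : ℕ, 1 ≤ n → ‖b n‖ ≤ C * (n : ℝ) ^ α) {c : ℕ} (hc : 1 ≤ c) {w : ℂ}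
    (hw0 : 0 < w.re) (hw : w.re < Real.pi) : DifferentiableAt ℂ (slashFun k N r c b) w := by
  have hE := exp_I_mul_sub_one_ne_zero hw0 hw
  have him := im_neg_inv_exp_I_mul_sub_one_pos hw0 hw
  rw [funext (slashFun_eq k N r c b)]
  refine DifferentiableAt.mul (DifferentiableAt.cpow ?_ (by fun_prop) ?_)
    (DifferentiableAt.comp w (differentiableAt_shiftedQSeries hr hb hc ?_) ?_)
  · exact DifferentiableAt.div (by fun_prop) (by fun_prop) hE
  · rw [Complex.mem_slitPlane_iff]
    right
    have h : Complex.exp (Complex.I * w) / (Complex.exp (Complex.I * w) - 1) =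
        1 - -(Complex.exp (Complex.I * w) - 1)⁻¹ := by
      field_simp
      ring
    rw [h, Complex.sub_im, Complex.one_im]
    linarith
  · rw [Complex.im_ofReal_mul]
    have hN' : (0 : ℝ) < N := by exact_mod_cast hN
    positivity
  · have hd : DifferentiableAt ℂ (fun v => Complex.exp (Complex.I * v) - 1) w := by fun_prop
    exact (hd.inv hE).neg.const_mul _

theorem re_im_bounds_of_dist_le {w : ℂ} {u : ℝ} (h : dist w u ≤ u / 2) :
    u / 2 ≤ w.re ∧ w.re ≤ 3 * u / 2 ∧ |w.im| ≤ u / 2 ∧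
      w.re ^ 2 + w.im ^ 2 ≤ 2 * w.re * u - 3 * u ^ 2 / 4 := by
  rw [Complex.dist_eq] at h
  have h1 := abs_le.1 ((Complex.abs_re_le_norm _).trans h)
  have h2 := (Complex.abs_im_le_norm _).trans h
  have h3 : Complex.normSq (w - u) ≤ (u / 2) ^ 2 := by
    rw [Complex.normSq_eq_norm_sq]
    gcongr
  rw [Complex.normSq_apply] at h3
  simp only [Complex.sub_re, Complex.sub_im, Complex.ofReal_re, Complex.ofReal_im, sub_zero]
    at h1 h2 h3
  exact ⟨by linarith, by linarith, h2, by linarith⟩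

theorem two_mul_div_three_mul_pi_le_sin {x : ℝ} (hx0 : 0 ≤ x) (hx : x ≤ 3 * Real.pi / 4) :
    2 * x / (3 * Real.pi) ≤ Real.sin x := by
  have hpi := Real.pi_pos
  rw [div_le_iff₀ (by positivity)]
  rcases le_total x (Real.pi / 2) with h | h
  · have h1 := Real.mul_le_sin hx0 h
    rw [div_mul_eq_mul_div, div_le_iff₀ hpi] at h1
    linarith
  · have h1 := Real.mul_le_sin (x := Real.pi - x) (by linarith) (by linarith)
    rw [Real.sin_pi_sub, div_mul_eq_mul_div, div_le_iff₀ hpi] at h1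
    linarith

theorem cosh_sub_cos_le_s8 {x y : ℝ} (hy : |y| ≤ Real.pi / 4) :
    Real.cosh y - Real.cos x ≤ 2 * (x ^ 2 + y ^ 2) / 3 := by
  have hpi := Real.pi_lt_d2
  have hy2 : y ^ 2 / 2 ≤ 0.32 := by
    have : y ^ 2 ≤ 0.79 ^ 2 := by
      rw [← sq_abs]
      gcongr
      linarith
    norm_num at this ⊢
    linarith
  have h0 : 0 ≤ y ^ 2 / 2 := by positivity
  have h1 := (abs_le.1 (Real.abs_exp_sub_one_sub_id_le (x := y ^ 2 / 2)
    (by rw [abs_of_nonneg h0]; linarith))).2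
  have h2 := Real.one_sub_sq_div_two_le_cos (x := x)
  nlinarith [Real.cosh_le_exp_half_sq y, mul_le_mul_of_nonneg_left hy2 h0, sq_nonneg x]

theorem le_im_neg_inv_exp_I_mul_sub_one {w : ℂ} {u : ℝ} (hu0 : 0 < u) (hu : u < Real.pi / 2)
    (h : dist w u ≤ u / 2) :
    1 / (3 * Real.pi * u) ≤ (-(Complex.exp (Complex.I * w) - 1)⁻¹).im := by
  obtain ⟨h1, h2, h3, h4⟩ := re_im_bounds_of_dist_le h
  have hpi := Real.pi_pos
  have hx0 : 0 < w.re := by linarith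
  have hD := cosh_sub_cos_pos w.im hx0 (by linarith)
  have hD' := cosh_sub_cos_le_s8 (x := w.re) (y := w.im) (by linarith)
  have hS := two_mul_div_three_mul_pi_le_sin hx0.le (by linarith)
  rw [div_le_iff₀ (by positivity)] at hS
  rw [im_neg_inv_exp_I_mul_sub_one, div_le_div_iff₀ (by positivity) (by positivity)]
  have h5 : 2 * (Real.cosh w.im - Real.cos w.re) ≤ 2 * w.re * u := by
    nlinarith
  nlinarith [mul_le_mul_of_nonneg_right hS hu0.le]

theorem norm_exp_I_mul_div_sub_one_le {w : ℂ} {u : ℝ} (hu0 : 0 < u) (hu : u < Real.pi / 2)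
    (h : dist w u ≤ u / 2) :
    ‖Complex.exp (Complex.I * w) / (Complex.exp (Complex.I * w) - 1)‖ ≤ 7 / u := by
  obtain ⟨h1, h2, h3, -⟩ := re_im_bounds_of_dist_le h
  have hpi := Real.pi_lt_d2
  have hpi0 := Real.pi_pos
  have hx0 : 0 < w.re := by linarith
  have hD := cosh_sub_cos_pos w.im hx0 (by linarith)
  have hcos := Real.cos_le_one_sub_mul_cos_sq (x := w.re)
    (by rw [abs_of_pos hx0]; linarith)
  have hD' : u ^ 2 / 20 ≤ Real.cosh w.im - Real.cos w.re := by
    have e1 : 1 / 5 * (u / 2) ^ 2 ≤ 2 / Real.pi ^ 2 * w.re ^ 2 := by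
      refine mul_le_mul ?_ (by gcongr) (by positivity) (by positivity)
      rw [div_le_div_iff₀ (by norm_num) (by positivity)]
      nlinarith
    linarith [Real.one_le_cosh w.im]
  have hexp : Real.exp (-w.im) ≤ 3 := by
    refine (Real.exp_le_exp.2 (?_ : -w.im ≤ 1)).trans Real.exp_one_lt_three.le
    linarith [neg_abs_le w.im]
  refine le_of_sq_le_sq ?_ (by positivity)
  rw [← Complex.normSq_eq_norm_sq, map_div₀, normSq_exp_I_mul_sub_one,
    Complex.normSq_eq_norm_sq, Complex.norm_exp, Complex.I_mul_re, sq, mul_right_comm,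
    mul_div_mul_right _ _ (Real.exp_ne_zero _), div_pow,
    div_le_div_iff₀ (by positivity) (by positivity)]
  nlinarith [mul_le_mul_of_nonneg_right hexp (sq_nonneg u)]

theorem norm_slashFun_le (k : ℕ) {N r : ℕ} (hN : 0 < N) (hr : 0 < r) {b : ℕ → ℂ}
    {C α : ℝ} (hb : ∀ n : ℕ, 1 ≤ n → ‖b n‖ ≤ C * (n : ℝ) ^ α) {c : ℕ} (hc : 1 ≤ c) {w : ℂ}
    {u : ℝ} (hu0 : 0 < u) (hu : u < Real.pi / 2) (h : dist w u ≤ u / 2) :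
    ‖slashFun k N r c b w‖ ≤ (7 / u) ^ ((k : ℝ) + 1 / 2) *
      (Real.exp (-(2 * (c : ℝ) / (9 * (r : ℝ) * Real.sqrt (N : ℝ))) / u) *
        ∑' n : ℕ, ‖b (n + c)‖ *
          Real.exp (-(1 / (18 * (r : ℝ) * Real.sqrt (N : ℝ))) * ((n + c : ℕ) : ℝ))) := by
  have hr' : (0 : ℝ) < r := by exact_mod_cast hr
  have hN' : 0 < Real.sqrt (N : ℝ) := Real.sqrt_pos.2 (by exact_mod_cast hN)
  have hpi := Real.pi_pos
  have hsqrt : Real.sqrt (4 * (N : ℝ)) = 2 * Real.sqrt (N : ℝ) := by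
    rw [Real.sqrt_mul (by norm_num), show (4 : ℝ) = 2 ^ 2 by norm_num, Real.sqrt_sq (by norm_num)]
  rw [slashFun_eq, norm_mul]
  gcongr ?_ * ?_
  · have hk : (k : ℂ) + 1 / 2 = (((k : ℝ) + 1 / 2 : ℝ) : ℂ) := by push_cast; rfl
    rw [hk, Complex.norm_cpow_real]
    gcongr
    exact norm_exp_I_mul_div_sub_one_le hu0 hu h
  · have hu2 : u ≤ 2 := by linarith [Real.pi_lt_d2]
    have hs : -(2 * (c : ℝ) / (9 * (r : ℝ) * Real.sqrt (N : ℝ))) / u =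
        -(2 / (9 * r * Real.sqrt (N : ℝ) * u)) * c := by
      field_simp
    rw [hs]
    refine norm_shiftedQSeries_le hb hc (by positivity) (by positivity) ?_
    have h1 : 1 / (18 * (r : ℝ) * Real.sqrt (N : ℝ)) ≤ 1 / (9 * r * Real.sqrt (N : ℝ) * u) := by
      apply one_div_le_one_div_of_le (by positivity)
      have : 0 < 9 * (r : ℝ) * Real.sqrt (N : ℝ) := by positivity
      nlinarith
    calc 2 / (9 * r * Real.sqrt (N : ℝ) * u) + 1 / (18 * (r : ℝ) * Real.sqrt (N : ℝ))
        ≤ 2 / (9 * r * Real.sqrt (N : ℝ) * u) + 1 / (9 * r * Real.sqrt (N : ℝ) * u) := by gcongr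
      _ = 2 * Real.pi * ((2 * Real.sqrt (N : ℝ))⁻¹ * (1 / (3 * Real.pi * u))) / r := by
        field_simp
        norm_num
      _ ≤ _ := by
        rw [Complex.im_ofReal_mul, hsqrt]
        gcongr
        exact le_im_neg_inv_exp_I_mul_sub_one hu0 hu h

/-- bounds for all derivatives of `H` on the real interval `(0, π/2)`. -/
theorem stmt_8 (k N r : ℕ) (hk : 0 < k) (hN : 0 < N) (hr : 0 < r)
    (b : ℕ → ℂ) (C α : ℝ) (hC : 0 < C) (hα : 0 < α)
    (hb : ∀ n : ℕ, 1 ≤ n → ‖b n‖ ≤ C * (n : ℝ) ^ α)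
    (c : ℕ) (hc : 1 ≤ c) (hbc : b c ≠ 0)
    (hmin : ∀ m : ℕ, 1 ≤ m → m < c → b m = 0) :
    ∃ C' > (0 : ℝ), ∀ p : ℕ, ∀ u : ℝ, 0 < u → u < Real.pi / 2 →
      ‖iteratedDeriv p (slashFun k N r c b) (u : ℂ)‖ ≤
        C' * 2 ^ p * (Nat.factorial p : ℝ) * u ^ (-((p : ℝ) + (k : ℝ) + 1 / 2)) *
          Real.exp (-(2 * (c : ℝ) * Real.exp (-Real.pi ^ 2 / 96) /
            (9 * (r : ℝ) * Real.sqrt (N : ℝ))) / u) := by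
  set S : ℝ := ∑' n : ℕ, ‖b (n + c)‖ *
    Real.exp (-(1 / (18 * (r : ℝ) * Real.sqrt (N : ℝ))) * ((n + c : ℕ) : ℝ))
  have hS : 0 ≤ S := tsum_nonneg fun n => by positivity
  refine ⟨7 ^ ((k : ℝ) + 1 / 2) * (S + 1), by positivity, fun p u hu0 hu => ?_⟩
  have hdist : ∀ w ∈ Metric.closedBall (u : ℂ) (u / 2),
      DifferentiableAt ℂ (slashFun k N r c b) w := by
    intro w hw
    obtain ⟨h1, h2, -, -⟩ := re_im_bounds_of_dist_le (Metric.mem_closedBall.1 hw)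
    exact differentiableAt_slashFun k hN hr hb hc (by linarith) (by linarith [Real.pi_pos])
  have hexp : Real.exp (-(2 * (c : ℝ) / (9 * (r : ℝ) * Real.sqrt (N : ℝ))) / u) ≤
      Real.exp (-(2 * (c : ℝ) * Real.exp (-Real.pi ^ 2 / 96) /
        (9 * (r : ℝ) * Real.sqrt (N : ℝ))) / u) := by
    have h1 : Real.exp (-Real.pi ^ 2 / 96) ≤ 1 :=
      Real.exp_le_one_iff.2 (by linarith [sq_nonneg Real.pi])
    have h2 : 2 * (c : ℝ) * Real.exp (-Real.pi ^ 2 / 96) ≤ 2 * c :=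
      mul_le_of_le_one_right (by positivity) h1
    gcongr
  refine (Complex.norm_iteratedDeriv_le_of_forall_mem_sphere_norm_le p (half_pos hu0)
    (DifferentiableOn.diffContOnCl_ball (U := Metric.closedBall (u : ℂ) (u / 2))
      (fun w hw => (hdist w hw).differentiableWithinAt) subset_rfl)
    (fun w hw => norm_slashFun_le k hN hr hb hc hu0 hu (Metric.mem_sphere.1 hw).le)).trans ?_
  have hpow : (7 / u) ^ ((k : ℝ) + 1 / 2) / (u / 2) ^ p =
      7 ^ ((k : ℝ) + 1 / 2) * 2 ^ p * u ^ (-((p : ℝ) + (k : ℝ) + 1 / 2)) := by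
    rw [add_assoc]
    generalize (k : ℝ) + 1 / 2 = κ
    rw [Real.div_rpow (by norm_num) hu0.le, Real.rpow_neg hu0.le, Real.rpow_add hu0,
      Real.rpow_natCast, div_pow]
    field_simp
  calc _ = (p.factorial : ℝ) * ((7 / u) ^ ((k : ℝ) + 1 / 2) / (u / 2) ^ p) *
        (Real.exp (-(2 * (c : ℝ) / (9 * (r : ℝ) * Real.sqrt (N : ℝ))) / u) * S) := by ring
    _ ≤ (p.factorial : ℝ) * ((7 / u) ^ ((k : ℝ) + 1 / 2) / (u / 2) ^ p) *
        (Real.exp (-(2 * (c : ℝ) * Real.exp (-Real.pi ^ 2 / 96) /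
          (9 * (r : ℝ) * Real.sqrt (N : ℝ))) / u) * (S + 1)) := by
      gcongr
      linarith
    _ = _ := by
      rw [hpow]
      ring
end
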